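/- arXiv:1207.2312 — 13 statements merged into one kernel-verified Lean document; each statement's English description precedes it below -/
import Mathlib

section
/- Let p be a prime and a : ℕ → ℂ be multiplicative (a(1) = 1 and a(mn) = a(m)a(n) whenever gcd(m,n) = 1) with Σ_{n≥1} |a(n)| n^{-σ} < ∞ for every σ > 1. For Re(s) > 1 set F(s) = Σ_{n≥1} a(n) n^{-s}, F(s,χ) = Σ_{n≥1} a(n) χ(n) n^{-s}, F(s, -b/p) = Σ_{n≥1} a(n) e(bn/p) n^{-s} with e(x) = e^{2πix}, and F_p(s) = Σ_{m≥0} a(p^m) p^{-ms}. Let τ(conj(χ)) denote the Gauss sum of conj(χ). Then for every s with Re(s) > 1 such that F_p(s) ≠ 0 and every integer b with gcd(b,p) = 1, F(s, -b/p) = (1/(p-1)) Σ_{χ mod p, χ ≠ χ₀} χ(b) τ(conj(χ)) F(s,χ) − ( (p/(p-1)) · (1/F_p(s)) − 1 ) · F(s), where χ₀ is the principal character mod p. -/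
lemma aux_char (p : ℕ) [Fact p.Prime] (x : ZMod p) (hx : x ≠ 0) :
    ∑ χ : DirichletCharacter ℂ p, χ x * gaussSum χ⁻¹ (ZMod.stdAddChar (N := p)) =
      ((p : ℂ) - 1) * ZMod.stdAddChar (N := p) x := by
  have h1 : ∀ y : ZMod p, ∑ χ : DirichletCharacter ℂ p, χ x * χ⁻¹ y =
      if x = y then ((p : ℂ) - 1) else 0 := by
    intro y
    have := DirichletCharacter.sum_characters_eq ℂ (x * y⁻¹)
    simp only [map_mul] at this
    simp only [MulChar.inv_apply']
    rw [this, Nat.totient_prime (Fact.out : p.Prime),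
      Nat.cast_sub (Fact.out : p.Prime).one_le, Nat.cast_one]
    have h2 : x * y⁻¹ = 1 ↔ x = y := by
      by_cases hy : y = 0
      · simp [hy, hx]
      · exact mul_inv_eq_one₀ hy
    simp only [h2]
  simp only [gaussSum, Finset.mul_sum]
  rw [Finset.sum_comm]
  simp only [← mul_assoc, ← Finset.sum_mul, h1]
  simp

lemma aux_gauss (p : ℕ) [Fact p.Prime] (χ : DirichletCharacter ℂ p) :
    (∑ c ∈ Finset.Icc 1 p, (starRingEnd ℂ) (χ ((c : ℕ) : ZMod p)) *
              Complex.exp (2 * Real.pi * Complex.I * c / p)) =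
    gaussSum χ⁻¹ (ZMod.stdAddChar (N := p)) := by
  have h0 : ∀ c : ℕ, (starRingEnd ℂ) (χ ((c : ℕ) : ZMod p)) *
      Complex.exp (2 * Real.pi * Complex.I * c / p) =
      χ⁻¹ (c : ZMod p) * ZMod.stdAddChar (N := p) (c : ZMod p) := by
    intro c
    have h := ZMod.stdAddChar_coe (N := p) (c : ℤ)
    push_cast at h
    rw [h, ← MulChar.star_apply']
    rfl
  simp only [h0, gaussSum]
  have hp : p.Prime := Fact.out
  refine Finset.sum_bij' (fun c _ => (c : ZMod p))
    (fun y _ => if y = 0 then p else y.val) ?_ ?_ ?_ ?_ ?_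
  · simp
  · intro y _
    rw [Finset.mem_Icc]
    split_ifs with h
    · exact ⟨hp.one_le, le_rfl⟩
    · exact ⟨Nat.one_le_iff_ne_zero.mpr (by simpa using h), (ZMod.val_lt y).le⟩
  · intro c hc
    rw [Finset.mem_Icc] at hc
    rcases hc.2.lt_or_eq with h | h
    · have : (c : ZMod p) ≠ 0 := by
        rw [Ne, ZMod.natCast_eq_zero_iff]
        exact Nat.not_dvd_of_pos_of_lt hc.1 h
      simp only [this, if_false]
      exact ZMod.val_cast_of_lt h
    · subst h; simp
  · intro y _
    split_ifs with h
    · simp [h]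
    · simp
  · intros; rfl

open Classical in
lemma aux_point (p : ℕ) [Fact p.Prime] (b n : ℕ) (hb : Nat.Coprime b p) :
    Complex.exp (2 * Real.pi * Complex.I * b * (n : ℂ) / p) =
      (1 / ((p : ℂ) - 1)) *
        ∑ χ ∈ Finset.univ.filter (fun χ : DirichletCharacter ℂ p => χ ≠ 1),
          χ ((b : ℕ) : ZMod p) * gaussSum χ⁻¹ (ZMod.stdAddChar (N := p)) * χ (n : ZMod p)
      - ((p : ℂ) / ((p : ℂ) - 1)) * (if p ∣ n then 0 else 1) + 1 := by
  have hp : p.Prime := Fact.out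
  have hp1 : (p : ℂ) - 1 ≠ 0 := by
    rw [sub_ne_zero]; exact_mod_cast hp.one_lt.ne'
  have hexp : Complex.exp (2 * Real.pi * Complex.I * b * (n : ℂ) / p) =
      ZMod.stdAddChar (N := p) ((b : ZMod p) * n) := by
    have h := ZMod.stdAddChar_coe (N := p) ((b * n : ℕ) : ℤ)
    push_cast at h
    rw [h]; congr 1; ring
  rw [hexp]
  by_cases hn : p ∣ n
  · have h0 : (n : ZMod p) = 0 := (ZMod.natCast_eq_zero_iff _ _).2 hn
    have hz : ∀ χ : DirichletCharacter ℂ p, χ (0 : ZMod p) = 0 := fun χ =>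
      χ.map_nonunit not_isUnit_zero
    simp [h0, hn, hz]
  · have h0 : (n : ZMod p) ≠ 0 := by rwa [Ne, ZMod.natCast_eq_zero_iff]
    have hb0 : (b : ZMod p) ≠ 0 := by
      rw [Ne, ZMod.natCast_eq_zero_iff]
      exact (Nat.Prime.coprime_iff_not_dvd hp).1 hb.symm
    have h := aux_char p ((b : ZMod p) * n) (mul_ne_zero hb0 h0)
    rw [← Finset.sum_filter_add_sum_filter_not _ (fun χ : DirichletCharacter ℂ p => χ ≠ 1)] at h
    have hf : Finset.univ.filter (fun χ : DirichletCharacter ℂ p => ¬ χ ≠ 1) = {1} := by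
      ext; simp
    rw [hf, Finset.sum_singleton, inv_one, gaussSum_one_left, MulChar.one_apply
      (isUnit_iff_ne_zero.2 (mul_ne_zero hb0 h0))] at h
    · have h3 : ∑ χ ∈ Finset.univ.filter (fun χ : DirichletCharacter ℂ p => χ ≠ 1),
          χ ((b : ℕ) : ZMod p) * gaussSum χ⁻¹ (ZMod.stdAddChar (N := p)) * χ (n : ZMod p) =
          ((p : ℂ) - 1) * ZMod.stdAddChar (N := p) ((b : ZMod p) * n) + 1 := by
        rw [← h]
        simp only [map_mul]
        rw [one_mul, neg_add_cancel_right]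
        exact Finset.sum_congr rfl fun χ _ => by ring
      rw [h3, if_neg hn]
      field_simp
      ring
    · intro h1
      have := ZMod.injective_stdAddChar (N := p) (a₁ := 1) (a₂ := 0) (by simp [h1])
      exact one_ne_zero this

lemma aux_prod (p : ℕ) (hp : p.Prime) (a : ℕ → ℂ)
    (hmul : ∀ m n : ℕ, Nat.Coprime m n → a (m * n) = a m * a n) (s : ℂ)
    (hsum : Summable fun n : ℕ+ => ‖a (n : ℕ) / ((n : ℕ) : ℂ) ^ s‖) :
    (∑' m : ℕ, a (p ^ m) / (p : ℂ) ^ ((m : ℂ) * s)) *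
      (∑' n : ℕ+, (if p ∣ (n : ℕ) then (0 : ℂ) else 1) * (a (n : ℕ) / ((n : ℕ) : ℂ) ^ s)) =
    ∑' n : ℕ+, a (n : ℕ) / ((n : ℕ) : ℂ) ^ s := by
  set f : ℕ+ → ℂ := fun n => a (n : ℕ) / ((n : ℕ) : ℂ) ^ s with hf
  let P : ℕ → ℕ+ := fun m => ⟨p ^ m, pow_pos hp.pos m⟩
  have hP : Function.Injective P := fun m m' h =>
    Nat.pow_right_injective hp.two_le (congrArg PNat.val h)
  have hfP : ∀ m : ℕ, a (p ^ m) / (p : ℂ) ^ ((m : ℂ) * s) = f (P m) := by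
    intro m
    simp only [hf, P, PNat.mk_coe]
    rw [Complex.natCast_cpow_natCast_mul]
    push_cast
    rfl
  have hG : (∑' n : ℕ+, (if p ∣ (n : ℕ) then (0 : ℂ) else 1) * (a (n : ℕ) / ((n : ℕ) : ℂ) ^ s))
      = ∑' k : {k : ℕ+ | ¬ p ∣ (k : ℕ)}, f k := by
    rw [tsum_subtype]
    refine tsum_congr fun n => ?_
    by_cases h : p ∣ (n : ℕ) <;> simp [Set.indicator, h, hf]
  have hbij : Function.Bijective
      (fun z : ℕ × {k : ℕ+ | ¬ p ∣ (k : ℕ)} => P z.1 * (z.2 : ℕ+)) := by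
    constructor
    · rintro ⟨m, k, hk⟩ ⟨m', k', hk'⟩ h
      have h1 : p ^ m * (k : ℕ) = p ^ m' * (k' : ℕ) := congrArg PNat.val h
      have key : ∀ (m : ℕ) (k : ℕ+), ¬ p ∣ (k : ℕ) → (p ^ m * (k : ℕ)).factorization p = m := by
        intro m k hk
        rw [Nat.factorization_mul (pow_pos hp.pos m).ne' k.pos.ne']
        simp [hp.factorization_self, Nat.factorization_eq_zero_of_not_dvd hk]
      have hm : m = m' := by rw [← key m k hk, h1, key m' k' hk']
      subst hm
      have hk2 : k = k' := PNat.eq (Nat.eq_of_mul_eq_mul_left (pow_pos hp.pos m) h1)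
      subst hk2
      rfl
    · intro n
      obtain ⟨e, k, hk, h⟩ := Nat.exists_eq_pow_mul_and_not_dvd n.pos.ne' p hp.ne_one
      refine ⟨⟨e, ⟨⟨k, Nat.pos_of_ne_zero fun h0 => hk (h0 ▸ dvd_zero p)⟩, hk⟩⟩, ?_⟩
      exact PNat.eq h.symm
  rw [hG]
  simp only [hfP]
  rw [tsum_mul_tsum_of_summable_norm (f := fun m => f (P m))
    (g := fun k : {k : ℕ+ | ¬ p ∣ (k : ℕ)} => f k)
    (hsum.comp_injective hP) (hsum.comp_injective Subtype.val_injective)]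
  rw [← (Equiv.ofBijective _ hbij).tsum_eq f]
  refine tsum_congr fun z => ?_
  obtain ⟨m, k, hk⟩ := z
  have hc : Nat.Coprime (p ^ m) (k : ℕ) := ((Nat.Prime.coprime_iff_not_dvd hp).2 hk).pow_left m
  change a (p ^ m) / ((p ^ m : ℕ) : ℂ) ^ s * (a (k : ℕ) / ((k : ℕ) : ℂ) ^ s) =
    a (p ^ m * (k : ℕ)) / ((p ^ m * (k : ℕ) : ℕ) : ℂ) ^ s
  rw [hmul _ _ hc, Nat.cast_mul, Complex.natCast_mul_natCast_cpow, mul_div_mul_comm]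


open Classical in
/-- Identity (2-5) of Lemma 2.2: a linear twist of a multiplicative Dirichlet series as a
combination of its multiplicative twists by the non-principal characters mod `p`, the series
itself, and the reciprocal of its `p`-th local Euler factor. -/
theorem stmt_3
    (p : ℕ) (hp : p.Prime) (a : ℕ → ℂ)
    (ha1 : a 1 = 1)
    (hmul : ∀ m n : ℕ, Nat.Coprime m n → a (m * n) = a m * a n)
    (hconv : ∀ σ : ℝ, 1 < σ →
      Summable fun n : ℕ+ => ‖a (n : ℕ)‖ / ((n : ℕ) : ℝ) ^ σ)
    (s : ℂ) (hs : 1 < s.re)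
    (hFp : ∑' m : ℕ, a (p ^ m) / (p : ℂ) ^ ((m : ℂ) * s) ≠ 0)
    (b : ℕ) (hb : Nat.Coprime b p) :
    ∑' n : ℕ+, a (n : ℕ) *
        Complex.exp (2 * Real.pi * Complex.I * b * ((n : ℕ) : ℂ) / p) / ((n : ℕ) : ℂ) ^ s =
      (1 / ((p : ℂ) - 1)) *
        ∑ χ ∈ Finset.univ.filter (fun χ : DirichletCharacter ℂ p => χ ≠ 1),
          χ ((b : ℕ) : ZMod p) *
            (∑ c ∈ Finset.Icc 1 p, (starRingEnd ℂ) (χ ((c : ℕ) : ZMod p)) *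
              Complex.exp (2 * Real.pi * Complex.I * c / p)) *
            (∑' n : ℕ+, a (n : ℕ) * χ ((n : ℕ) : ZMod p) / ((n : ℕ) : ℂ) ^ s)
      - (((p : ℂ) / ((p : ℂ) - 1)) * (∑' m : ℕ, a (p ^ m) / (p : ℂ) ^ ((m : ℂ) * s))⁻¹ - 1) *
          ∑' n : ℕ+, a (n : ℕ) / ((n : ℕ) : ℂ) ^ s := by
  have : Fact p.Prime := ⟨hp⟩
  have hnorm : Summable fun n : ℕ+ => ‖a (n : ℕ) / ((n : ℕ) : ℂ) ^ s‖ := by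
    refine (hconv s.re hs).congr fun n => ?_
    rw [norm_div, Complex.norm_natCast_cpow_of_pos n.pos]
  have hprod := aux_prod p hp a hmul s hnorm
  simp only [aux_gauss]
  set Fp := ∑' m : ℕ, a (p ^ m) / (p : ℂ) ^ ((m : ℂ) * s)
  set F := ∑' n : ℕ+, a (n : ℕ) / ((n : ℕ) : ℂ) ^ s
  have hF : HasSum (fun n : ℕ+ => a (n : ℕ) / ((n : ℕ) : ℂ) ^ s) F := hnorm.of_norm.hasSum
  have hGs : Summable fun n : ℕ+ =>
      (if p ∣ (n : ℕ) then (0 : ℂ) else 1) * (a (n : ℕ) / ((n : ℕ) : ℂ) ^ s) := by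
    refine Summable.of_norm_bounded hnorm fun n => ?_
    split_ifs
    · rw [zero_mul, norm_zero]; exact norm_nonneg _
    · rw [one_mul]
  have hG := hGs.hasSum
  have hGv : (∑' n : ℕ+, (if p ∣ (n : ℕ) then (0 : ℂ) else 1) *
      (a (n : ℕ) / ((n : ℕ) : ℂ) ^ s)) = Fp⁻¹ * F := by
    rw [← hprod, inv_mul_cancel_left₀ hFp]
  rw [hGv] at hG
  have hχ : ∀ χ : DirichletCharacter ℂ p, HasSum
      (fun n : ℕ+ => a (n : ℕ) * χ ((n : ℕ) : ZMod p) / ((n : ℕ) : ℂ) ^ s)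
      (∑' n : ℕ+, a (n : ℕ) * χ ((n : ℕ) : ZMod p) / ((n : ℕ) : ℂ) ^ s) := by
    intro χ
    refine (Summable.of_norm_bounded hnorm fun n => ?_).hasSum
    rw [mul_div_right_comm, norm_mul]
    exact mul_le_of_le_one_right (norm_nonneg _) (χ.norm_le_one _)
  have hS := hasSum_sum (s := Finset.univ.filter (fun χ : DirichletCharacter ℂ p => χ ≠ 1))
    fun χ _ => (hχ χ).mul_left (χ ((b : ℕ) : ZMod p) *
      gaussSum χ⁻¹ (ZMod.stdAddChar (N := p)))
  have hT := ((hS.mul_left (1 / ((p : ℂ) - 1))).sub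
    (hG.mul_left ((p : ℂ) / ((p : ℂ) - 1)))).add hF
  have hfun : (fun n : ℕ+ => a (n : ℕ) *
        Complex.exp (2 * Real.pi * Complex.I * b * ((n : ℕ) : ℂ) / p) / ((n : ℕ) : ℂ) ^ s) =
    (fun n : ℕ+ => (1 / ((p : ℂ) - 1)) *
      ∑ χ ∈ Finset.univ.filter (fun χ : DirichletCharacter ℂ p => χ ≠ 1),
          χ ((b : ℕ) : ZMod p) * gaussSum χ⁻¹ (ZMod.stdAddChar (N := p)) *
            (a (n : ℕ) * χ ((n : ℕ) : ZMod p) / ((n : ℕ) : ℂ) ^ s) -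
      ((p : ℂ) / ((p : ℂ) - 1)) *
        ((if p ∣ (n : ℕ) then (0 : ℂ) else 1) * (a (n : ℕ) / ((n : ℕ) : ℂ) ^ s)) +
      a (n : ℕ) / ((n : ℕ) : ℂ) ^ s) := by
    funext n
    rw [aux_point p b n hb]
    have : ∀ A c S t d X : ℂ, A * (c * S - t * d + 1) / X =
      c * (S * (A / X)) - t * (d * (A / X)) + A / X := by intros; ring
    rw [this, Finset.sum_mul]
    congr 3
    exact Finset.sum_congr rfl fun χ _ => by ring
  rw [hfun, hT.tsum_eq]
  have halg : ∀ c S t u F : ℂ, c * S - t * (u * F) + F = c * S - (t * u - 1) * F := by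
    intros; ring
  rw [halg]
  congr!
end

section
/- Let r ≥ 1, λ_1,…,λ_r > 0 with Σ_{j=1}^r λ_j = 1, and μ_1,…,μ_r ∈ ℂ with Re(μ_j) ≥ 0. Define G(s,w) = ((2π)^{1-r}/Γ(1-w)) ∏_{j=1}^r Γ(λ_j(1-s-w) + conj(μ_j)) Γ(1 - λ_j(s+w) - μ_j). Then there exist positive constants c₀, c₁, c₂, A, c such that for every s = σ + it ∈ ℂ and every real v ≥ c₁|s| + c₂, writing w = -σ - c₀ + iv, one has |G(s,w)| ≤ A^{|s|} · e^{-πv/2} · (v + |σ|)^{|σ| + c}. -/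
lemma intg (x b : ℝ) (hx : 0 < x) (hb : 0 < b) :
    MeasureTheory.IntegrableOn (fun t : ℝ => t ^ (x - 1) * Real.exp (-(b * t))) (Set.Ioi 0) := by
  have := integrableOn_rpow_mul_exp_neg_mul_rpow (p := 1) (s := x - 1) (by linarith) (by norm_num) hb
  simpa using this

lemma intc (a ρ : ℂ) : MeasureTheory.AEStronglyMeasurable
    (fun t : ℝ => (t:ℂ) ^ (a - 1) * Complex.exp (-(ρ * t)))
    (MeasureTheory.volume.restrict (Set.Ioi 0)) := by
  refine ContinuousOn.aestronglyMeasurable ?_ measurableSet_Ioi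
  refine ContinuousOn.mul ?_ (by fun_prop)
  intro t ht
  have ht' : 0 < t := ht
  refine ContinuousAt.continuousWithinAt ?_
  exact Complex.continuousAt_ofReal_cpow_const _ _ (Or.inr ht'.ne')

lemma nrm (a ρ : ℂ) (t : ℝ) (ht : 0 < t) : ‖(t:ℂ) ^ (a - 1) * Complex.exp (-(ρ * t))‖ =
    t ^ (a.re - 1) * Real.exp (-(ρ.re * t)) := by
  rw [norm_mul, Complex.norm_cpow_eq_rpow_re_of_pos ht, Complex.norm_exp]
  simp

lemma cint (a ρ : ℂ) (ha : 0 < a.re) (hρ : 0 < ρ.re) : MeasureTheory.IntegrableOn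
    (fun t : ℝ => (t:ℂ) ^ (a - 1) * Complex.exp (-(ρ * t))) (Set.Ioi 0) := by
  refine MeasureTheory.Integrable.mono' (intg a.re ρ.re ha hρ) (intc a ρ) ?_
  filter_upwards [MeasureTheory.ae_restrict_mem measurableSet_Ioi] with t ht
  exact (nrm a ρ t ht).le

lemma cder (a ρ : ℂ) (ha : 0 < a.re) (hρ : 0 < ρ.re) : DifferentiableAt ℂ
    (fun ρ : ℂ => ∫ t in Set.Ioi (0:ℝ), (t:ℂ) ^ (a - 1) * Complex.exp (-(ρ * t))) ρ := by
  have hs : {z : ℂ | ρ.re / 2 < z.re} ∈ nhds ρ :=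
    (isOpen_lt continuous_const Complex.continuous_re).mem_nhds (by simp; linarith)
  refine (hasDerivAt_integral_of_dominated_loc_of_deriv_le
    (μ := MeasureTheory.volume.restrict (Set.Ioi (0:ℝ))) (𝕜 := ℂ) (E := ℂ)
    (F := fun (z : ℂ) (t : ℝ) => (t:ℂ) ^ (a - 1) * Complex.exp (-(z * t)))
    (F' := fun (z : ℂ) (t : ℝ) => -((t:ℂ) ^ (a + 1 - 1) * Complex.exp (-(z * t))))
    (bound := fun t : ℝ => t ^ (a.re + 1 - 1) * Real.exp (-(ρ.re / 2 * t)))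
    hs ?_ (cint a ρ ha hρ) (intc (a+1) ρ).neg ?_ (intg (a.re + 1) (ρ.re / 2) (by linarith) (by linarith))
    ?_).2.differentiableAt
  · exact Filter.Eventually.of_forall fun z => intc a z
  · filter_upwards [MeasureTheory.ae_restrict_mem measurableSet_Ioi] with t ht
    intro z hz
    have ht' : 0 < t := ht
    have hz' : ρ.re / 2 < z.re := hz
    rw [norm_neg, nrm (a+1) z t ht]
    simp only [Complex.add_re, Complex.one_re]
    gcongr
  · filter_upwards [MeasureTheory.ae_restrict_mem measurableSet_Ioi] with t ht
    intro z hz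
    have ht' : 0 < t := ht
    have h1 : HasDerivAt (fun z : ℂ => -(z * t)) (-(t:ℂ)) z := by
      have h := ((hasDerivAt_id z).mul_const (t:ℂ)).neg
      rw [one_mul] at h
      exact h
    have h2 := (h1.cexp).const_mul ((t:ℂ) ^ (a - 1))
    have ht0 : (t:ℂ) ≠ 0 := by exact_mod_cast ht'.ne'
    refine h2.congr_deriv ?_
    rw [add_sub_cancel_right, Complex.cpow_sub _ _ ht0, Complex.cpow_one]
    field_simp

lemma cgam (a ρ : ℂ) (ha : 0 < a.re) (hρ : 0 < ρ.re) :
    ∫ t in Set.Ioi (0:ℝ), (t:ℂ) ^ (a - 1) * Complex.exp (-(ρ * t)) = (1 / ρ) ^ a * Complex.Gamma a := by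
  have ho : IsOpen {z : ℂ | 0 < z.re} := isOpen_lt continuous_const Complex.continuous_re
  have h1 : AnalyticOnNhd ℂ
      (fun ρ : ℂ => ∫ t in Set.Ioi (0:ℝ), (t:ℂ) ^ (a - 1) * Complex.exp (-(ρ * t)))
      {z : ℂ | 0 < z.re} :=
    DifferentiableOn.analyticOnNhd (fun z hz => (cder a z ha hz).differentiableWithinAt) ho
  have h2 : AnalyticOnNhd ℂ (fun ρ : ℂ => (1 / ρ) ^ a * Complex.Gamma a) {z : ℂ | 0 < z.re} := by
    refine DifferentiableOn.analyticOnNhd (fun z hz => DifferentiableAt.differentiableWithinAt ?_) ho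
    have hz' : 0 < z.re := hz
    have hz0 : z ≠ 0 := by rintro rfl; simp at hz'
    refine DifferentiableAt.mul_const ?_ _
    refine DifferentiableAt.cpow (by fun_prop (disch := exact hz0)) (by fun_prop) ?_
    left
    rw [one_div, Complex.inv_re]
    exact div_pos hz' (Complex.normSq_pos.2 hz0)
  have hc : IsPreconnected {z : ℂ | 0 < z.re} := (convex_halfSpace_re_gt 0).isPreconnected
  refine h1.eqOn_of_preconnected_of_frequently_eq h2 hc (z₀ := 1) (by simp) ?_ hρ
  have ht : Filter.Tendsto (fun n : ℕ => ((1 + 1 / ((n:ℝ) + 1) : ℝ) : ℂ)) Filter.atTop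
      (nhdsWithin 1 {1}ᶜ) := by
    rw [tendsto_nhdsWithin_iff]
    constructor
    · have := (tendsto_one_div_add_atTop_nhds_zero_nat (𝕜 := ℝ)).const_add 1
      have h := (Complex.continuous_ofReal.tendsto _).comp this
      simpa [Function.comp_def] using h
    · refine Filter.Eventually.of_forall fun n => ?_
      have : (1 + 1 / ((n:ℝ) + 1) : ℝ) ≠ 1 := by
        have : 0 < 1 / ((n:ℝ) + 1) := by positivity
        linarith
      simp only [Set.mem_compl_iff, Set.mem_singleton_iff]
      exact_mod_cast this
  refine ht.frequently (Filter.Eventually.frequently (Filter.Eventually.of_forall fun n => ?_))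
  exact Complex.integral_cpow_mul_exp_neg_mul_Ioi ha (by positivity)

lemma rot (x y θ : ℝ) (hx : 0 < x) (h1 : -(Real.pi/2) < θ) (h2 : θ < Real.pi/2) :
    ‖Complex.Gamma ((x:ℂ) + y * Complex.I)‖ ≤
      Real.exp (-(θ * y)) * Real.Gamma x * (1 / Real.cos θ) ^ x := by
  set a : ℂ := (x:ℂ) + y * Complex.I with ha
  have hare : a.re = x := by simp [ha]
  have hcos : 0 < Real.cos θ := Real.cos_pos_of_mem_Ioo ⟨h1, h2⟩
  set ρ : ℂ := Complex.exp (θ * Complex.I) with hρ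
  have hρre : ρ.re = Real.cos θ := by rw [hρ, Complex.exp_ofReal_mul_I_re]
  have key := cgam a ρ (by rw [hare]; exact hx)
    (by rw [hρre]; exact hcos)
  have hreal := Real.integral_rpow_mul_exp_neg_mul_Ioi hx hcos
  have hn : ‖(1 / ρ) ^ a‖ = Real.exp (θ * y) := by
    have : 1 / ρ = Complex.exp (((-θ : ℝ) : ℂ) * Complex.I) := by
      rw [hρ, one_div, ← Complex.exp_neg]; push_cast; ring_nf
    rw [this, Complex.cpow_def_of_ne_zero (Complex.exp_ne_zero _), Complex.log_exp, Complex.norm_exp]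
    · simp [ha]
    · simp; linarith
    · simp; linarith
  have hle : ‖(1 / ρ) ^ a * Complex.Gamma a‖ ≤ (1 / Real.cos θ) ^ x * Real.Gamma x := by
    rw [← key, ← hreal]
    refine (MeasureTheory.norm_integral_le_integral_norm _).trans (le_of_eq ?_)
    refine MeasureTheory.setIntegral_congr_fun measurableSet_Ioi ?_
    intro t ht
    have ht' : 0 < t := ht
    simp only [norm_mul]
    rw [Complex.norm_cpow_eq_rpow_re_of_pos ht', Complex.norm_exp]
    simp [hare, hρre]
  rw [norm_mul, hn] at hle
  rw [Real.exp_neg, mul_assoc, inv_mul_eq_div, le_div_iff₀ (Real.exp_pos _)]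
  linarith

lemma base (x y : ℝ) (hx : 1 ≤ x) (hx2 : x ≤ 2) (hy : 1 ≤ |y|) :
    ‖Complex.Gamma ((x:ℂ) + y * Complex.I)‖ ≤
      8 * Real.exp (-(Real.pi / 2 * |y|)) * |y| ^ 2 := by
  have hy0 : 0 < |y| := by linarith
  have hG : Real.Gamma x ≤ 1 := by
    have := Real.convexOn_Gamma.2 (show (1:ℝ) ∈ Set.Ioi 0 by simp) (show (2:ℝ) ∈ Set.Ioi 0 by simp)
      (show 0 ≤ 2 - x by linarith) (show 0 ≤ x - 1 by linarith) (by ring)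
    simp only [smul_eq_mul, Real.Gamma_one, Real.Gamma_two] at this
    ring_nf at this
    exact this
  have hG0 : 0 < Real.Gamma x := Real.Gamma_pos_of_pos (by linarith)
  have hπ := Real.pi_gt_three
  have hi : 1 / |y| ≤ 1 := by rw [div_le_one hy0]; exact hy
  have hi0 : 0 < 1 / |y| := by positivity
  set φ : ℝ := Real.pi / 2 - 1 / |y| with hφ
  have hc : Real.cos φ = Real.sin (1/|y|) := by rw [hφ, Real.cos_pi_div_two_sub]
  have hs : 2 / Real.pi * (1/|y|) ≤ Real.sin (1/|y|) := Real.mul_le_sin hi0.le (by linarith)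
  have hs0 : 0 < 2 / Real.pi * (1/|y|) := by positivity
  have hq : (1 / Real.cos φ) ^ x ≤ (Real.pi / 2 * |y|) ^ (2:ℕ) := by
    have h1 : 1 / Real.cos φ ≤ Real.pi / 2 * |y| := by
      rw [hc]
      refine (one_div_le_one_div_of_le hs0 hs).trans (le_of_eq ?_)
      field_simp
    have h2 : 1 ≤ Real.pi / 2 * |y| := by nlinarith
    have h3 : 0 ≤ 1 / Real.cos φ := by
      rw [hc]; exact div_nonneg zero_le_one (hs0.le.trans hs)
    calc (1 / Real.cos φ) ^ x ≤ (Real.pi / 2 * |y|) ^ x := Real.rpow_le_rpow h3 h1 (by linarith)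
      _ ≤ (Real.pi / 2 * |y|) ^ (2:ℝ) := Real.rpow_le_rpow_of_exponent_le h2 hx2
      _ = _ := by norm_cast
  have hq0 : 0 ≤ (1 / Real.cos φ) ^ x := by
    refine Real.rpow_nonneg ?_ _
    rw [hc]; exact div_nonneg zero_le_one (hs0.le.trans hs)
  have fin : Real.exp (-(φ * |y|)) * Real.Gamma x * (1 / Real.cos φ) ^ x ≤
      8 * Real.exp (-(Real.pi / 2 * |y|)) * |y| ^ 2 := by
    have e1 : Real.exp (-(φ * |y|)) = Real.exp 1 * Real.exp (-(Real.pi / 2 * |y|)) := by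
      rw [← Real.exp_add, hφ]; congr 1; field_simp; ring
    have e2 := Real.exp_one_lt_d9
    have e3 := Real.pi_lt_d2
    have e4 : Real.exp 1 * (Real.pi / 2) ^ 2 ≤ 8 := by
      have : (Real.pi/2)^2 ≤ 2.5 := by nlinarith
      nlinarith [Real.exp_pos 1]
    calc _ ≤ Real.exp (-(φ * |y|)) * 1 * (Real.pi / 2 * |y|) ^ (2:ℕ) := by gcongr
      _ = (Real.exp 1 * (Real.pi / 2) ^ 2) * Real.exp (-(Real.pi / 2 * |y|)) * |y| ^ 2 := by
        rw [e1]; ring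
      _ ≤ _ := by gcongr
  refine le_trans ?_ fin
  rcases le_total 0 y with h | h
  · have := rot x y φ (by linarith) (by rw [hφ]; linarith) (by rw [hφ]; linarith)
    rwa [abs_of_nonneg h] at *
  · have := rot x y (-φ) (by linarith) (by rw [hφ]; linarith) (by rw [hφ]; linarith)
    rw [Real.cos_neg] at this
    have e : -φ * y = φ * |y| := by rw [abs_of_nonpos h]; ring
    rwa [e] at this

lemma im_ne (x y : ℝ) (hy : 1 ≤ |y|) : ((x:ℂ) + y * Complex.I) ≠ 0 := by
  intro h
  have := congrArg Complex.im h
  simp at this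
  rw [this] at hy; norm_num at hy

lemma down (y : ℝ) (hy : 1 ≤ |y|) (n : ℕ) : ∀ x : ℝ, 1 - n ≤ x → x ≤ 2 →
    ‖Complex.Gamma ((x:ℂ) + y * Complex.I)‖ ≤
      8 * Real.exp (-(Real.pi / 2 * |y|)) * |y| ^ 2 := by
  induction n with
  | zero => intro x h h2; exact base x y (by simpa using h) h2 hy
  | succ n ih =>
    intro x h h2
    push_cast at h
    by_cases hx : 1 ≤ x
    · exact base x y hx h2 hy
    · have := ih (x+1) (by linarith) (by linarith)
      have e : ((x+1 : ℝ):ℂ) + y * Complex.I = ((x:ℂ) + y * Complex.I) + 1 := by push_cast; ring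
      rw [e, Complex.Gamma_add_one _ (im_ne x y hy), norm_mul] at this
      have hn : 1 ≤ ‖(x:ℂ) + y * Complex.I‖ := by
        have := Complex.abs_im_le_norm ((x:ℂ) + y * Complex.I)
        simp at this
        linarith
      refine le_trans ?_ this
      exact le_mul_of_one_le_left (norm_nonneg _) hn

lemma up (y : ℝ) (hy : 1 ≤ |y|) (n : ℕ) : ∀ x : ℝ, 1 ≤ x → x ≤ 2 + n →
    ‖Complex.Gamma ((x:ℂ) + y * Complex.I)‖ ≤
      8 * Real.exp (-(Real.pi / 2 * |y|)) * (x + |y|) ^ (x + 2) := by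
  have hb : ∀ x : ℝ, 1 ≤ x → x ≤ 2 → ‖Complex.Gamma ((x:ℂ) + y * Complex.I)‖ ≤
      8 * Real.exp (-(Real.pi / 2 * |y|)) * (x + |y|) ^ (x + 2) := by
    intro x h h2
    refine (base x y h h2 hy).trans ?_
    gcongr
    calc |y| ^ 2 ≤ (x + |y|) ^ 2 := by gcongr; linarith
      _ = (x + |y|) ^ (2:ℝ) := by norm_cast
      _ ≤ _ := Real.rpow_le_rpow_of_exponent_le (by linarith) (by linarith)
  induction n with
  | zero => intro x h h2; exact hb x h (by simpa using h2)
  | succ n ih =>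
    intro x h h2
    push_cast at h2
    by_cases hx : x ≤ 2
    · exact hb x h hx
    · push Not at hx
      have := ih (x-1) (by linarith) (by linarith)
      have e : (x:ℂ) + y * Complex.I = (((x-1:ℝ):ℂ) + y * Complex.I) + 1 := by push_cast; ring
      rw [e, Complex.Gamma_add_one _ (im_ne (x-1) y hy), norm_mul]
      have hn : ‖((x-1:ℝ):ℂ) + y * Complex.I‖ ≤ x + |y| := by
        have := Complex.norm_le_abs_re_add_abs_im (((x-1:ℝ):ℂ) + y * Complex.I)
        simp at this
        rw [abs_of_nonneg (by linarith : (0:ℝ) ≤ x - 1)] at this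
        push_cast
        linarith
      have h0 : 0 < x + |y| := by linarith
      calc _ ≤ (x + |y|) * (8 * Real.exp (-(Real.pi / 2 * |y|)) * (x - 1 + |y|) ^ (x - 1 + 2)) := by
            gcongr
        _ ≤ (x + |y|) * (8 * Real.exp (-(Real.pi / 2 * |y|)) * (x + |y|) ^ (x - 1 + 2)) := by
            have : (x - 1 + |y|) ^ (x - 1 + 2) ≤ (x + |y|) ^ (x - 1 + 2) :=
              Real.rpow_le_rpow (by linarith) (by linarith) (by linarith)
            gcongr
        _ = _ := by
            have : (x + |y|) ^ (x + 2) = (x + |y|) ^ (x - 1 + 2) * (x + |y|) := by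
              rw [← Real.rpow_add_one h0.ne']; congr 1; ring
            rw [this]; ring

lemma gam (x y : ℝ) (hy : 1 ≤ |y|) (N Y : ℝ) (hN : |x| + 2 ≤ N) (hY : |x| + |y| ≤ Y) :
    ‖Complex.Gamma ((x:ℂ) + y * Complex.I)‖ ≤
      8 * Real.exp (-(Real.pi / 2 * |y|)) * Y ^ N := by
  have hx0 := abs_nonneg x
  suffices h : ‖Complex.Gamma ((x:ℂ) + y * Complex.I)‖ ≤
      8 * Real.exp (-(Real.pi / 2 * |y|)) * (|x| + |y|) ^ (|x| + 2) by
    refine h.trans ?_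
    gcongr
    exact (Real.rpow_le_rpow_of_exponent_le (by linarith) hN).trans
      (Real.rpow_le_rpow (by linarith) hY (by linarith))
  rcases le_total x 1 with h | h
  · obtain ⟨n, hn⟩ := exists_nat_ge (1 - x)
    refine (down y hy n x (by linarith) (by linarith)).trans ?_
    gcongr
    calc |y| ^ 2 ≤ (|x| + |y|) ^ 2 := by gcongr; linarith
      _ = (|x| + |y|) ^ (2:ℝ) := by norm_cast
      _ ≤ _ := Real.rpow_le_rpow_of_exponent_le (by linarith) (by linarith)
  · obtain ⟨n, hn⟩ := exists_nat_ge (x - 2)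
    have := up y hy n x h (by linarith)
    rwa [abs_of_nonneg (by linarith : 0 ≤ x)]

lemma sinb (z : ℂ) : ‖Complex.sin z‖ ≤ Real.exp |z.im| := by
  rw [Complex.sin]
  have h1 : ‖Complex.exp (-z * Complex.I)‖ ≤ Real.exp |z.im| := by
    rw [Complex.norm_exp]; simpa using le_abs_self _
  have h2 : ‖Complex.exp (z * Complex.I)‖ ≤ Real.exp |z.im| := by
    rw [Complex.norm_exp]; simpa using neg_le_abs _
  have := norm_sub_le (Complex.exp (-z * Complex.I)) (Complex.exp (z * Complex.I))
  simp only [norm_div, norm_mul, Complex.norm_I, mul_one, Complex.norm_ofNat]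
  linarith

lemma invGam (w : ℂ) (hw : w.im ≠ 0) :
    ‖Complex.Gamma (1 - w)‖⁻¹ ≤ Real.exp (Real.pi * |w.im|) * ‖Complex.Gamma w‖ := by
  have h := Complex.Gamma_mul_Gamma_one_sub w
  have hs : Complex.sin (Real.pi * w) ≠ 0 := by
    rw [Complex.sin_ne_zero_iff]
    intro k hk
    have := congrArg Complex.im hk
    simp at this
    exact hw this
  have hg : Complex.Gamma (1 - w) ≠ 0 := by
    intro h0
    rw [h0, mul_zero, eq_comm, div_eq_zero_iff] at h
    rcases h with h | h
    · exact Real.pi_ne_zero (by exact_mod_cast h)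
    · exact hs h
  have hb := sinb (Real.pi * w)
  have him : ((Real.pi:ℂ) * w).im = Real.pi * w.im := by simp
  rw [him, abs_mul, abs_of_pos Real.pi_pos] at hb
  have hn : ‖Complex.Gamma w‖ * ‖Complex.Gamma (1-w)‖ * ‖Complex.sin (Real.pi * w)‖ = Real.pi := by
    rw [← norm_mul, ← norm_mul, h, div_mul_cancel₀ _ hs]
    simp [abs_of_pos Real.pi_pos]
  rw [inv_le_iff_one_le_mul₀ (norm_pos_iff.2 hg)]
  have : ‖Complex.Gamma w‖ * ‖Complex.Gamma (1-w)‖ * ‖Complex.sin (Real.pi * w)‖ ≤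
    ‖Complex.Gamma w‖ * ‖Complex.Gamma (1-w)‖ * Real.exp (Real.pi * |w.im|) := by gcongr
  linarith [Real.pi_gt_three]

/-- Lemma 3.1: uniform bound for the Gamma-quotient `G(s,w)` arising from a degree-2
functional equation, for `w` on the vertical half-line `Re w = -σ - c₀`, `Im w = v ≥ c₁|s| + c₂`. -/
theorem stmt_4
    (r : ℕ) (hr : 1 ≤ r) (lam : Fin r → ℝ) (hlam : ∀ j, 0 < lam j)
    (hsum : ∑ j, lam j = 1) (mu : Fin r → ℂ) (hmu : ∀ j, 0 ≤ (mu j).re) :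
    ∃ c₀ c₁ c₂ A c : ℝ, 0 < c₀ ∧ 0 < c₁ ∧ 0 < c₂ ∧ 0 < A ∧ 0 < c ∧
      ∀ s : ℂ, ∀ v : ℝ, c₁ * ‖s‖ + c₂ ≤ v →
        ∀ w : ℂ, w = -(s.re : ℂ) - (c₀ : ℂ) + v * Complex.I →
          norm
            (((2 * Real.pi : ℝ) : ℂ) ^ ((1 : ℤ) - (r : ℤ)) / Complex.Gamma (1 - w) *
              ∏ j, Complex.Gamma ((lam j : ℂ) * (1 - s - w) + (starRingEnd ℂ) (mu j)) *
                Complex.Gamma (1 - (lam j : ℂ) * (s + w) - mu j)) ≤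
            A ^ ‖s‖ * Real.exp (-(Real.pi * v) / 2) *
              (v + |s.re|) ^ (|s.re| + c) := by
  obtain ⟨M, hM⟩ : ∃ M : ℝ, ∀ j, |2 * lam j + (mu j).re| + 2 ≤ M ∧ |1 + lam j - (mu j).re| + 2 ≤ M ∧
      |(mu j).im| ≤ M ∧ (1 + |(mu j).im|) / lam j ≤ M := by
    obtain ⟨M, hM⟩ := (Set.finite_range (fun j => (|2 * lam j + (mu j).re| + 2) ⊔
      (|1 + lam j - (mu j).re| + 2) ⊔ |(mu j).im| ⊔ ((1 + |(mu j).im|) / lam j))).bddAbove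
    refine ⟨M, fun j => ?_⟩
    have := hM ⟨j, rfl⟩
    simp only [sup_le_iff] at this
    tauto
  have hM0 : 0 < M := by
    have := (hM ⟨0, hr⟩).1
    have := abs_nonneg (2 * lam ⟨0, hr⟩ + (mu ⟨0, hr⟩).re)
    linarith
  have hpi := Real.pi_pos
  refine ⟨1, 1, M + 8, 2 * Real.exp Real.pi, Real.pi * (r * M) + r * (2 + 4 * M) + 5, one_pos,
    one_pos, by linarith, by positivity, by positivity, ?_⟩
  intro s v hv w hw
  have hs0 := norm_nonneg s
  have hre : |s.re| ≤ ‖s‖ := Complex.abs_re_le_norm s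
  have him := abs_le.1 (Complex.abs_im_le_norm s)
  have hre0 := abs_nonneg s.re
  set X := v + |s.re| with hX
  have hX8 : 8 ≤ X := by linarith
  have hX0 : 0 < X := by linarith
  have hX1 : 1 ≤ X := by linarith
  have hv1 : 1 ≤ |v| := by rw [abs_of_nonneg (by linarith)]; linarith
  have hvabs : |v| = v := abs_of_nonneg (by linarith)
  -- the reciprocal factor
  have hwim : w.im = v := by simp [hw]
  have hA : ‖Complex.Gamma (1 - w)‖⁻¹ ≤
      Real.exp (Real.pi * v / 2) * (2 ^ ‖s‖ * X ^ (|s.re| + 5)) := by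
    have h1 := invGam w (by rw [hwim]; intro h; linarith)
    have hab : |-s.re - 1| ≤ |s.re| + 1 := by
      have := abs_sub (-s.re) 1
      simpa using this
    have h2 := gam (-s.re - 1) v hv1 (|s.re| + 3) (2 * X) (by linarith) (by linarith)
    have e : ((-s.re - 1 : ℝ) : ℂ) + v * Complex.I = w := by rw [hw]; push_cast; ring
    rw [e, hvabs] at h2
    rw [hwim, hvabs] at h1
    have h3 : 8 * (2 * X) ^ (|s.re| + 3) ≤ 2 ^ ‖s‖ * X ^ (|s.re| + 5) := by
      rw [Real.mul_rpow (by norm_num) hX0.le, Real.rpow_add (by norm_num)]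
      have e5 : X ^ (|s.re| + 5) = X * X * X ^ (|s.re| + 3) := by
        have : |s.re| + 5 = |s.re| + 3 + 1 + 1 := by ring
        rw [this, Real.rpow_add_one hX0.ne', Real.rpow_add_one hX0.ne']; ring
      have e6 : (2:ℝ) ^ |s.re| ≤ 2 ^ ‖s‖ := Real.rpow_le_rpow_of_exponent_le (by norm_num) hre
      have e7 : (2:ℝ) ^ (3:ℝ) = 8 := by norm_num
      rw [e5, e7]
      calc 8 * ((2:ℝ) ^ |s.re| * 8 * X ^ (|s.re| + 3))
          = 2 ^ |s.re| * (8 * 8 * X ^ (|s.re| + 3)) := by ring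
        _ ≤ _ := by gcongr
    calc _ ≤ _ := h1
      _ ≤ Real.exp (Real.pi * v) * (8 * Real.exp (-(Real.pi / 2 * v)) * (2 * X) ^ (|s.re| + 3)) := by
        gcongr
      _ = (Real.exp (Real.pi * v) * Real.exp (-(Real.pi / 2 * v))) *
          (8 * (2 * X) ^ (|s.re| + 3)) := by ring
      _ = Real.exp (Real.pi * v / 2) * (8 * (2 * X) ^ (|s.re| + 3)) := by
        rw [← Real.exp_add]; congr 2; ring
      _ ≤ _ := by gcongr
  -- the numerator factors
  have hB : ∀ j, ‖Complex.Gamma ((lam j : ℂ) * (1 - s - w) + (starRingEnd ℂ) (mu j)) *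
      Complex.Gamma (1 - (lam j : ℂ) * (s + w) - mu j)‖ ≤
      Real.exp (-(Real.pi * (lam j * (s.im + v) + (mu j).im))) * X ^ (2 + 4 * M) := by
    intro j
    obtain ⟨m1, m2, m3, m4⟩ := hM j
    have hl := hlam j
    have hl1 : lam j ≤ 1 := by
      rw [← hsum]
      exact Finset.single_le_sum (fun i _ => (hlam i).le) (Finset.mem_univ j)
    rw [div_le_iff₀ hl] at m4
    have m3a := neg_abs_le (mu j).im
    have m3b := le_abs_self (mu j).im
    set y := lam j * (s.im + v) + (mu j).im with hy
    have hy1 : 1 ≤ y := by nlinarith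
    have hy2 : y ≤ 2 * v + M := by nlinarith
    have hya : |-y| = y := by rw [abs_neg, abs_of_nonneg (by linarith)]
    have hone : ∀ x : ℝ, |x| + 2 ≤ M → ‖Complex.Gamma ((x:ℂ) + (-y : ℝ) * Complex.I)‖ ≤
        Real.exp (-(Real.pi / 2 * y)) * X ^ (1 + 2 * M) := by
      intro x hx
      have := gam x (-y) (by rw [hya]; exact hy1) M (X ^ (2:ℝ)) hx (by
        rw [hya]
        have : X ^ (2:ℝ) = X ^ 2 := by norm_cast
        rw [this]
        nlinarith)
      rw [hya, ← Real.rpow_mul hX0.le] at this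
      refine this.trans ?_
      rw [Real.rpow_add hX0, Real.rpow_one]
      calc _ = Real.exp (-(Real.pi / 2 * y)) * (8 * X ^ (2 * M)) := by ring
        _ ≤ _ := by gcongr
    have f1 := hone _ m1
    have f2 := hone _ m2
    have e1 : ((2 * lam j + (mu j).re : ℝ) : ℂ) + (-y : ℝ) * Complex.I =
        (lam j : ℂ) * (1 - s - w) + (starRingEnd ℂ) (mu j) := by
      rw [hw]; apply Complex.ext <;> simp [hy] <;> ring
    have e2 : ((1 + lam j - (mu j).re : ℝ) : ℂ) + (-y : ℝ) * Complex.I =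
        1 - (lam j : ℂ) * (s + w) - mu j := by
      rw [hw]; apply Complex.ext <;> simp [hy] <;> ring
    rw [e1] at f1
    rw [e2] at f2
    rw [norm_mul]
    calc _ ≤ (Real.exp (-(Real.pi / 2 * y)) * X ^ (1 + 2 * M)) *
          (Real.exp (-(Real.pi / 2 * y)) * X ^ (1 + 2 * M)) := by gcongr
      _ = (Real.exp (-(Real.pi / 2 * y)) * Real.exp (-(Real.pi / 2 * y))) *
          (X ^ (1 + 2 * M) * X ^ (1 + 2 * M)) := by ring
      _ = _ := by rw [← Real.exp_add, ← Real.rpow_add hX0]; congr 2 <;> ring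
  have hP : ‖∏ j, Complex.Gamma ((lam j : ℂ) * (1 - s - w) + (starRingEnd ℂ) (mu j)) *
      Complex.Gamma (1 - (lam j : ℂ) * (s + w) - mu j)‖ ≤
      Real.exp (-(Real.pi * v)) * (Real.exp Real.pi ^ ‖s‖) *
        X ^ (Real.pi * (r * M) + r * (2 + 4 * M)) := by
    rw [norm_prod]
    refine (Finset.prod_le_prod (fun j _ => norm_nonneg _) (fun j _ => hB j)).trans ?_
    rw [Finset.prod_mul_distrib, ← Real.exp_sum, Finset.prod_const, Finset.card_univ,
      Fintype.card_fin, ← Real.rpow_natCast, ← Real.rpow_mul hX0.le, Real.rpow_add hX0,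
      ← Real.exp_mul, mul_comm (2 + 4 * M) (r:ℝ), ← mul_assoc]
    refine mul_le_mul_of_nonneg_right ?_ (by positivity)
    have hmu' : -(r * M) ≤ ∑ j, (mu j).im := by
      have : ∑ j : Fin r, (-M) ≤ ∑ j, (mu j).im :=
        Finset.sum_le_sum fun j _ => by
          have := neg_abs_le (mu j).im
          linarith [(hM j).2.2.1]
      simpa using this
    have hse : ∑ j, -(Real.pi * (lam j * (s.im + v) + (mu j).im)) =
        -(Real.pi * (s.im + v + ∑ j, (mu j).im)) := by
      rw [Finset.sum_neg_distrib, ← Finset.mul_sum, Finset.sum_add_distrib, ← Finset.sum_mul, hsum,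
        one_mul]
    have hXe : Real.exp (Real.pi * (r * M)) ≤ X ^ (Real.pi * (r * M)) := by
      rw [← Real.exp_one_rpow]
      refine Real.rpow_le_rpow (Real.exp_pos _).le ?_ (by positivity)
      linarith [Real.exp_one_lt_d9]
    rw [hse]
    calc _ ≤ Real.exp (-(Real.pi * v) + Real.pi * ‖s‖ + Real.pi * (r * M)) := by
          apply Real.exp_le_exp.2
          nlinarith
      _ = Real.exp (-(Real.pi * v)) * Real.exp (Real.pi * ‖s‖) * Real.exp (Real.pi * (r * M)) := by
          rw [Real.exp_add, Real.exp_add]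
      _ ≤ _ := by gcongr
  have hC : ‖((2 * Real.pi : ℝ) : ℂ) ^ ((1 : ℤ) - (r : ℤ))‖ ≤ 1 := by
    rw [norm_zpow, Complex.norm_real, Real.norm_of_nonneg (by positivity)]
    apply zpow_le_one_of_nonpos₀
    · linarith [Real.pi_gt_three]
    · omega
  rw [norm_mul, norm_div, div_eq_mul_inv]
  calc _ ≤ 1 * (Real.exp (Real.pi * v / 2) * (2 ^ ‖s‖ * X ^ (|s.re| + 5))) *
        (Real.exp (-(Real.pi * v)) * (Real.exp Real.pi ^ ‖s‖) *
        X ^ (Real.pi * (r * M) + r * (2 + 4 * M))) := by gcongr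
    _ = (2 ^ ‖s‖ * Real.exp Real.pi ^ ‖s‖) *
        (Real.exp (Real.pi * v / 2) * Real.exp (-(Real.pi * v))) *
        (X ^ (|s.re| + 5) * X ^ (Real.pi * (r * M) + r * (2 + 4 * M))) := by ring
    _ = _ := by
      rw [← Real.mul_rpow (by norm_num) (Real.exp_pos _).le, ← Real.exp_add, ← Real.rpow_add hX0]
      congr 2
      · congr 1; ring
      · ring
end

section
/- Let r ≥ 1, λ_1,…,λ_r > 0 with Σ_{j=1}^r λ_j = 1, and μ_1,…,μ_r ∈ ℂ with Re(μ_j) ≥ 0, and set ξ = 2 Σ_{j=1}^r (μ_j - 1/2). Define S(s,w) = (2^{r-1}/sin(πw)) ∏_{j=1}^r sin(π(λ_j(s+w) + μ_j)). Then there exist positive constants c₀, c₁, c₂, A, c such that for every s = σ + it ∈ ℂ and every real v ≥ c₁|s| + c₂, writing w = -σ - c₀ + iv, one has |S(s,w) + i·e(-ξ/4)·e^{-πis}| ≤ |e(-ξ/4)·e^{-πis}| · A^{|s|} e^{-cv}, where e(x) = e^{2πix}. -/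
lemma aux_sin (z : ℂ) : Complex.sin z =
    (Complex.I / 2) * Complex.exp (-(z * Complex.I)) * (1 - Complex.exp (2 * z * Complex.I)) := by
  have h : Complex.exp (2 * z * Complex.I) =
      Complex.exp (z * Complex.I) * Complex.exp (z * Complex.I) := by
    rw [← Complex.exp_add]; congr 1; ring
  have h2 : Complex.exp (-(z * Complex.I)) * Complex.exp (z * Complex.I) = 1 := by
    rw [← Complex.exp_add]; simp
  rw [Complex.sin, h, neg_mul]
  linear_combination (Complex.I / 2 * Complex.exp (z * Complex.I)) * h2

lemma aux_quot (r : ℕ) (hr : 1 ≤ r) (lam : Fin r → ℝ)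
    (hsum : ∑ j, lam j = 1) (mu : Fin r → ℂ)
    (ξ : ℂ) (hξ : ξ = 2 * ∑ j, (mu j - 1 / 2)) (s w : ℂ)
    (hb : 1 - Complex.exp (2 * (Real.pi * w) * Complex.I) ≠ 0) :
    (2 : ℂ) ^ (r - 1) / Complex.sin (Real.pi * w) *
                ∏ j, Complex.sin (Real.pi * ((lam j : ℂ) * (s + w) + mu j)) =
      -Complex.I * (Complex.exp (2 * Real.pi * Complex.I * (-ξ / 4)) *
                Complex.exp (-(Real.pi * Complex.I * s))) *
        ((∏ j, (1 - Complex.exp (2 * (Real.pi * ((lam j : ℂ) * (s + w) + mu j)) * Complex.I)))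
          / (1 - Complex.exp (2 * (Real.pi * w) * Complex.I))) := by
  have hsum' : ∑ j, (lam j : ℂ) = 1 := by exact_mod_cast hsum
  obtain ⟨n, rfl⟩ : ∃ n, r = n + 1 := ⟨r - 1, by omega⟩
  rw [aux_sin (Real.pi * w)]
  simp_rw [aux_sin (Real.pi * (_ * _ + _))]
  rw [Finset.prod_mul_distrib, Finset.prod_mul_distrib, Finset.prod_const, ← Complex.exp_sum]
  have e1 : ∑ j, -((Real.pi : ℂ) * ((lam j : ℂ) * (s + w) + mu j) * Complex.I)
      = -(Real.pi * s * Complex.I) + -(Real.pi * w * Complex.I)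
        + -(Real.pi * (∑ j, mu j) * Complex.I) := by
    rw [Finset.sum_neg_distrib, ← Finset.sum_mul, ← Finset.mul_sum, Finset.sum_add_distrib,
      ← Finset.sum_mul, hsum']
    ring
  have e2 : 2 * (Real.pi : ℂ) * Complex.I * (-ξ / 4) =
      -(Real.pi * (∑ j, mu j) * Complex.I) + ((n + 1 : ℕ) : ℂ) * (Real.pi / 2 * Complex.I) := by
    rw [hξ, Finset.sum_sub_distrib]
    simp
    ring
  rw [e1, e2, Complex.exp_add, Complex.exp_add, Complex.exp_add, Complex.exp_nat_mul,
    Complex.exp_pi_div_two_mul_I]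
  have e3 : -((Real.pi : ℂ) * Complex.I * s) = -(Real.pi * s * Complex.I) := by ring
  rw [e3]
  simp only [Finset.card_univ, Fintype.card_fin, Nat.add_sub_cancel, div_pow]
  have hI : Complex.I ≠ 0 := Complex.I_ne_zero
  have he := Complex.exp_ne_zero (-(Real.pi * w * Complex.I))
  generalize (∏ j, (1 - Complex.exp (2 * (Real.pi * ((lam j : ℂ) * (s + w) + mu j)) *
    Complex.I))) = P
  generalize 1 - Complex.exp (2 * (Real.pi * w) * Complex.I) = B at hb ⊢
  field_simp
  rw [pow_succ]
  ring_nf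
  simp [Complex.I_sq]

lemma aux_bound (r : ℕ) (a : Fin r → ℂ) (b : ℂ) (q : ℝ) (hr : 1 ≤ r)
    (ha : ∀ j, ‖a j‖ ≤ q) (hb : ‖b‖ ≤ q) (hq : 6 * r * q ≤ 1) :
    1 - b ≠ 0 ∧ ‖(∏ j, (1 - a j)) / (1 - b) - 1‖ ≤ 6 * r * q := by
  have hr' : (1 : ℝ) ≤ r := by exact_mod_cast hr
  have q0 : 0 ≤ q := (norm_nonneg b).trans hb
  have hqr : q ≤ r * q := by nlinarith
  have hlow : 1 / 2 ≤ ‖1 - b‖ := by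
    have := norm_sub_norm_le (1 : ℂ) b
    rw [norm_one] at this
    linarith
  have hne : 1 - b ≠ 0 := by
    intro h; rw [h, norm_zero] at hlow; linarith
  refine ⟨hne, ?_⟩
  have h1 : ‖∏ j, (1 + (- a j)) - 1‖ ≤ Real.exp (∑ j, ‖- a j‖) - 1 :=
    Finset.norm_prod_one_add_sub_one_le _ _
  have h2 : ∑ j, ‖- a j‖ ≤ r * q := by
    calc _ ≤ ∑ j : Fin r, q := Finset.sum_le_sum (fun j _ => by rw [norm_neg]; exact ha j)
      _ = r * q := by simp
  have h3 : Real.exp (∑ j, ‖- a j‖) - 1 ≤ 2 * (r * q) := by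
    have h := Real.abs_exp_sub_one_le (x := r * q) (by rw [abs_of_nonneg (by positivity)]; linarith)
    rw [abs_of_nonneg (a := (r : ℝ) * q) (by positivity)] at h
    have := Real.exp_le_exp.2 h2
    linarith [le_abs_self (Real.exp (r * q) - 1)]
  simp_rw [← sub_eq_add_neg] at h1
  have h4 : (∏ j, (1 - a j)) / (1 - b) - 1 = ((∏ j, (1 - a j) - 1) + b) / (1 - b) := by
    field_simp; ring
  rw [h4, norm_div, div_le_iff₀ (by linarith)]
  have h5 := norm_add_le (∏ j, (1 - a j) - 1) b
  have : 6 * r * q * (1 / 2) ≤ 6 * r * q * ‖1 - b‖ := by gcongr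
  linarith

/-- Lemma 3.2: on the vertical half-line `Re w = -σ - c₀`, `Im w = v ≥ c₁|s| + c₂`, the
sine-quotient `S(s,w)` from a degree-2 functional equation equals
`-i e(-ξ/4) e^{-πis} (1 + O(A^{|s|} e^{-cv}))`. -/
theorem stmt_5
    (r : ℕ) (hr : 1 ≤ r) (lam : Fin r → ℝ) (hlam : ∀ j, 0 < lam j)
    (hsum : ∑ j, lam j = 1) (mu : Fin r → ℂ) (hmu : ∀ j, 0 ≤ (mu j).re)
    (ξ : ℂ) (hξ : ξ = 2 * ∑ j, (mu j - 1 / 2)) :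
    ∃ c₀ c₁ c₂ A c : ℝ, 0 < c₀ ∧ 0 < c₁ ∧ 0 < c₂ ∧ 0 < A ∧ 0 < c ∧
      ∀ s : ℂ, ∀ v : ℝ, c₁ * norm s + c₂ ≤ v →
        ∀ w : ℂ, w = -(s.re : ℂ) - (c₀ : ℂ) + v * Complex.I →
          norm
            ((2 : ℂ) ^ (r - 1) / Complex.sin (Real.pi * w) *
                ∏ j, Complex.sin (Real.pi * ((lam j : ℂ) * (s + w) + mu j)) +
              Complex.I * Complex.exp (2 * Real.pi * Complex.I * (-ξ / 4)) *
                Complex.exp (-(Real.pi * Complex.I * s))) ≤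
            norm (Complex.exp (2 * Real.pi * Complex.I * (-ξ / 4)) *
                Complex.exp (-(Real.pi * Complex.I * s))) *
              A ^ norm s * Real.exp (-c * v) := by
  have hr' : (1 : ℝ) ≤ r := by exact_mod_cast hr
  have hpi := Real.pi_pos
  obtain ⟨j0, -, hj0⟩ := Finset.exists_min_image (Finset.univ : Finset (Fin r)) lam
    ⟨⟨0, hr⟩, Finset.mem_univ _⟩
  obtain ⟨l, hl⟩ : ∃ l, l = lam j0 := ⟨_, rfl⟩
  have l0 : 0 < l := hl ▸ hlam j0
  have hll : ∀ j, l ≤ lam j := fun j => hl ▸ hj0 j (Finset.mem_univ _)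
  have l1 : l ≤ 1 := by
    rw [hl, ← hsum]
    exact Finset.single_le_sum (fun j _ => (hlam j).le) (Finset.mem_univ j0)
  obtain ⟨M, hM⟩ : ∃ M, M = ∑ j, ‖mu j‖ := ⟨_, rfl⟩
  have M0 : 0 ≤ M := by rw [hM]; positivity
  have hMj : ∀ j, -M ≤ (mu j).im := fun j => by
    have h1 : ‖mu j‖ ≤ M := by
      rw [hM]
      exact Finset.single_le_sum (f := fun j => ‖mu j‖) (fun j _ => norm_nonneg _)
        (Finset.mem_univ j)
    have h2 := (abs_le.1 (Complex.abs_im_le_norm (mu j))).1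
    linarith
  obtain ⟨c, hc⟩ : ∃ c, c = Real.pi * l / 2 := ⟨_, rfl⟩
  have c0 : 0 < c := by rw [hc]; positivity
  obtain ⟨K, hK⟩ : ∃ K, K = Real.log (6 * r) + 2 * Real.pi * M := ⟨_, rfl⟩
  have K0 : 0 ≤ K := by
    have := Real.log_nonneg (x := 6 * r) (by linarith)
    rw [hK]; positivity
  refine ⟨1, 2, 1 + K / c, 1, c, one_pos, two_pos, by positivity, one_pos, c0, ?_⟩
  intro s v hv w hw
  have hs := norm_nonneg s
  have hsim := (abs_le.1 (Complex.abs_im_le_norm s)).1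
  have hKc : 0 ≤ K / c := by positivity
  have v0 : 0 < v := by linarith
  have hcv : K ≤ c * v := by
    have : K / c ≤ v := by linarith
    rwa [div_le_iff₀' c0] at this
  have htv : v / 2 ≤ s.im + v := by linarith
  have hwim : w.im = v := by rw [hw]; simp
  obtain ⟨q, hq⟩ : ∃ q, q = Real.exp (2 * Real.pi * M - 2 * c * v) := ⟨_, rfl⟩
  have h6 : 6 * r * q ≤ Real.exp (-c * v) := by
    have : (6 * r : ℝ) = Real.exp (Real.log (6 * r)) := (Real.exp_log (by linarith)).symm
    rw [this, hq, ← Real.exp_add]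
    apply Real.exp_le_exp.2
    linarith
  have h61 : 6 * r * q ≤ 1 := h6.trans (by
    apply Real.exp_le_one_iff.2
    nlinarith)
  have hnorm : ∀ z : ℂ, ‖Complex.exp (2 * (Real.pi * z) * Complex.I)‖
      = Real.exp (-(2 * Real.pi * z.im)) := fun z => by
    rw [Complex.norm_exp]; congr 1; simp; ring
  have ha : ∀ j, ‖Complex.exp (2 * (Real.pi * ((lam j : ℂ) * (s + w) + mu j)) * Complex.I)‖ ≤ q := by
    intro j
    rw [hnorm, hq]
    apply Real.exp_le_exp.2
    have e : ((lam j : ℂ) * (s + w) + mu j).im = lam j * (s.im + v) + (mu j).im := by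
      simp [hwim]
    have h1 : l * (v / 2) ≤ lam j * (s.im + v) :=
      mul_le_mul (hll j) htv (by positivity) (hlam j).le
    have h2 : Real.pi * (l * (v / 2) - M) ≤ Real.pi * (lam j * (s.im + v) + (mu j).im) := by
      have := hMj j
      gcongr
      linarith
    rw [e, hc]
    linarith
  have hb : ‖Complex.exp (2 * (Real.pi * w) * Complex.I)‖ ≤ q := by
    rw [hnorm, hq, hwim, hc]
    apply Real.exp_le_exp.2
    have h1 : Real.pi * v * l ≤ Real.pi * v * 1 := by gcongr
    have h2 : 0 ≤ Real.pi * M := by positivity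
    have h3 : 0 ≤ Real.pi * v := by positivity
    linarith
  obtain ⟨hne, hE⟩ := aux_bound r _ _ q hr ha hb h61
  rw [aux_quot r hr lam hsum mu ξ hξ s w hne, Real.one_rpow, mul_one]
  obtain ⟨E, hEE⟩ : ∃ E, E = (∏ j, (1 - Complex.exp (2 * (Real.pi * ((lam j : ℂ) * (s + w) + mu j)) * Complex.I)))
          / (1 - Complex.exp (2 * (Real.pi * w) * Complex.I)) := ⟨_, rfl⟩
  rw [← hEE] at hE ⊢
  rw [mul_assoc Complex.I]
  generalize Complex.exp (2 * Real.pi * Complex.I * (-ξ / 4)) *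
                Complex.exp (-(Real.pi * Complex.I * s)) = T
  have : -Complex.I * T * E + Complex.I * T = -Complex.I * T * (E - 1) := by ring
  rw [this, norm_mul, norm_mul, norm_neg, Complex.norm_I, one_mul]
  gcongr
  exact hE.trans h6
end

section
/- Let r ≥ 1, λ_1,…,λ_r > 0 and μ_1,…,μ_r ∈ ℂ. For n ≥ 0 set H(n) = 2 Σ_{j=1}^r B_n(μ_j)/λ_j^{n-1}, where B_n is the n-th Bernoulli polynomial, and write 2 Σ_{j=1}^r (μ_j - 1/2) = η + iθ with η, θ ∈ ℝ. Then for every integer ν ≥ 1 and every s ∈ ℂ, B_{ν+1}(1 - 2s - iθ) + B_{ν+1}(1) + (1/2) Σ_{k=0}^{ν+1} binom(ν+1, k) ( (-1)^ν H(k) s^{ν+1-k} - conj(H(k)) (1-s)^{ν+1-k} ) = B_{ν+1}(1 - 2s - iθ) + B_{ν+1}(1) - Σ_{j=1}^r ( B_{ν+1}(λ_j(1-s) + conj(μ_j)) + B_{ν+1}(1 - λ_j s - μ_j) ) / λ_j^ν. -/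
theorem hasse_bern (n k : ℕ) (h : k ≤ n) :
    Polynomial.hasseDeriv k (Polynomial.bernoulli n) =
      (n.choose k : ℚ) • Polynomial.bernoulli (n - k) := by
  ext i
  rw [Polynomial.hasseDeriv_coeff, Polynomial.coeff_smul, Polynomial.coeff_bernoulli,
    Polynomial.coeff_bernoulli]
  by_cases hi : i + k ≤ n
  · have h2 : i ≤ n - k := by omega
    have h3 : n - k - i = n - (i + k) := by omega
    have h4 := Nat.choose_mul (n := n) (k := i + k) (s := k) (by omega)
    rw [Nat.add_sub_cancel] at h4
    have h5 : ((n.choose (i + k) : ℚ)) * ((i + k).choose k) = n.choose k * (n - k).choose i := by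
      exact_mod_cast h4
    rw [if_pos hi, if_pos h2, h3, smul_eq_mul]
    linear_combination (_root_.bernoulli (n - (i + k))) * h5
  · have h2 : ¬ i ≤ n - k := by omega
    rw [if_neg hi, if_neg h2]
    simp

theorem bern_add (n : ℕ) (x y : ℂ) :
    Polynomial.aeval (x + y) (Polynomial.bernoulli n) =
      ∑ k ∈ Finset.range (n + 1), (n.choose k : ℂ) *
        Polynomial.aeval x (Polynomial.bernoulli k) * y ^ (n - k) := by
  have hdeg : (Polynomial.bernoulli n).natDegree < n + 1 := by
    rw [Nat.lt_succ_iff, Polynomial.natDegree_le_iff_coeff_eq_zero]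
    intro N hN
    rw [Polynomial.coeff_bernoulli, if_neg (by omega)]
  set f := (Polynomial.bernoulli n).map (algebraMap ℚ ℂ) with hf
  have h1 : Polynomial.aeval (x + y) (Polynomial.bernoulli n) =
      (Polynomial.taylor x f).eval y := by
    rw [Polynomial.taylor_eval, hf, Polynomial.eval_map_algebraMap, add_comm]
  have hd2 : (Polynomial.taylor x f).natDegree < n + 1 := by
    rw [Polynomial.natDegree_taylor]
    exact lt_of_le_of_lt Polynomial.natDegree_map_le hdeg
  rw [h1, Polynomial.eval_eq_sum_range' hd2, ← Finset.sum_range_reflect]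
  refine Finset.sum_congr rfl fun k hk => ?_
  have hk' : k ≤ n := by simpa [Nat.lt_succ_iff] using hk
  have e : n + 1 - 1 - k = n - k := by omega
  have hmap : Polynomial.hasseDeriv (n - k)
      ((Polynomial.bernoulli n).map (algebraMap ℚ ℂ)) =
      (Polynomial.hasseDeriv (n - k) (Polynomial.bernoulli n)).map (algebraMap ℚ ℂ) := by
    ext i
    simp only [Polynomial.hasseDeriv_coeff, Polynomial.coeff_map, map_mul, map_natCast]
  rw [e, Polynomial.taylor_coeff, hf, hmap, hasse_bern _ _ (Nat.sub_le _ _),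
    Nat.sub_sub_self hk', Nat.choose_symm hk', Polynomial.eval_map_algebraMap]
  simp [Algebra.smul_def]

theorem bern_one_sub (n : ℕ) (x : ℂ) :
    Polynomial.aeval (1 - x) (Polynomial.bernoulli n) =
      (-1) ^ n * Polynomial.aeval x (Polynomial.bernoulli n) := by
  have := congrArg (Polynomial.aeval x) (Polynomial.bernoulli_comp_one_sub_X n)
  simpa [Polynomial.aeval_comp] using this

theorem bern_conj (n : ℕ) (x : ℂ) :
    (starRingEnd ℂ) (Polynomial.aeval x (Polynomial.bernoulli n)) =
      Polynomial.aeval ((starRingEnd ℂ) x) (Polynomial.bernoulli n) := by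
  simp [Polynomial.bernoulli, map_sum]

theorem bern_scaled (ν : ℕ) (l x y : ℂ) (hl : l ≠ 0) :
    Polynomial.aeval (x + l * y) (Polynomial.bernoulli (ν + 1)) / l ^ ν =
      ∑ k ∈ Finset.range (ν + 2), ((ν + 1).choose k : ℂ) *
        (Polynomial.aeval x (Polynomial.bernoulli k) / l ^ ((k : ℤ) - 1)) * y ^ (ν + 1 - k) := by
  rw [bern_add, Finset.sum_div]
  refine Finset.sum_congr rfl fun k hk => ?_
  have hk' : k ≤ ν + 1 := by simpa [Nat.lt_succ_iff] using hk
  obtain ⟨m, hm⟩ := Nat.exists_eq_add_of_le hk'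
  have hm' : ν + 1 - k = m := by omega
  have key : l ^ m * l ^ ((k : ℤ) - 1) = l ^ ν := by
    rw [← zpow_natCast, ← zpow_natCast, ← zpow_add₀ hl]
    congr 1
    omega
  have hz : l ^ ((k : ℤ) - 1) ≠ 0 := zpow_ne_zero _ hl
  rw [hm', mul_pow, ← key]
  field_simp


/-- Lemma 3.3: the polynomials `R_ν(s)` defined via the `H`-invariants admit a closed
Bernoulli-polynomial expression. `B n z` denotes the `n`-th Bernoulli polynomial at `z`. -/
theorem stmt_6
    (r : ℕ) (hr : 1 ≤ r) (lam : Fin r → ℝ) (hlam : ∀ j, 0 < lam j)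
    (mu : Fin r → ℂ)
    (H : ℕ → ℂ)
    (hH : ∀ n : ℕ, H n =
      2 * ∑ j, Polynomial.aeval (mu j) (Polynomial.bernoulli n) / (lam j : ℂ) ^ ((n : ℤ) - 1))
    (η θ : ℝ) (hξ : 2 * ∑ j, (mu j - 1 / 2) = (η : ℂ) + (θ : ℂ) * Complex.I)
    (ν : ℕ) (hν : 1 ≤ ν) (s : ℂ) :
    Polynomial.aeval (1 - 2 * s - (θ : ℂ) * Complex.I) (Polynomial.bernoulli (ν + 1)) +
        Polynomial.aeval (1 : ℂ) (Polynomial.bernoulli (ν + 1)) +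
        (1 / 2) * ∑ k ∈ Finset.range (ν + 2), ((ν + 1).choose k : ℂ) *
          ((-1 : ℂ) ^ ν * H k * s ^ (ν + 1 - k) -
            (starRingEnd ℂ) (H k) * (1 - s) ^ (ν + 1 - k)) =
      Polynomial.aeval (1 - 2 * s - (θ : ℂ) * Complex.I) (Polynomial.bernoulli (ν + 1)) +
        Polynomial.aeval (1 : ℂ) (Polynomial.bernoulli (ν + 1)) -
        ∑ j, (Polynomial.aeval ((lam j : ℂ) * (1 - s) + (starRingEnd ℂ) (mu j))
              (Polynomial.bernoulli (ν + 1)) +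
            Polynomial.aeval (1 - (lam j : ℂ) * s - mu j) (Polynomial.bernoulli (ν + 1))) /
          (lam j : ℂ) ^ ν := by
  have hl : ∀ j, (lam j : ℂ) ≠ 0 := fun j => by exact_mod_cast (hlam j).ne'
  have hHc : ∀ n : ℕ, (starRingEnd ℂ) (H n) = 2 * ∑ j,
      Polynomial.aeval ((starRingEnd ℂ) (mu j)) (Polynomial.bernoulli n) /
        (lam j : ℂ) ^ ((n : ℤ) - 1) := by
    intro n
    rw [hH, map_mul, map_sum]
    rw [show (starRingEnd ℂ) 2 = 2 from map_ofNat _ 2]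
    simp [bern_conj, map_zpow₀]
  have hA : ∑ j, Polynomial.aeval ((lam j : ℂ) * (1 - s) + (starRingEnd ℂ) (mu j))
        (Polynomial.bernoulli (ν + 1)) / (lam j : ℂ) ^ ν =
      (1 / 2) * ∑ k ∈ Finset.range (ν + 2), ((ν + 1).choose k : ℂ) *
        ((starRingEnd ℂ) (H k) * (1 - s) ^ (ν + 1 - k)) := by
    simp_rw [add_comm _ ((starRingEnd ℂ) (mu _)), bern_scaled ν _ _ _ (hl _)]
    rw [Finset.sum_comm, Finset.mul_sum]
    refine Finset.sum_congr rfl fun k _ => ?_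
    rw [hHc, ← Finset.sum_mul, ← Finset.mul_sum]
    ring
  have hB : ∑ j, Polynomial.aeval (1 - (lam j : ℂ) * s - mu j)
        (Polynomial.bernoulli (ν + 1)) / (lam j : ℂ) ^ ν =
      -((1 / 2) * ∑ k ∈ Finset.range (ν + 2), ((ν + 1).choose k : ℂ) *
        ((-1 : ℂ) ^ ν * H k * s ^ (ν + 1 - k))) := by
    have h1 : ∀ j, Polynomial.aeval (1 - (lam j : ℂ) * s - mu j)
        (Polynomial.bernoulli (ν + 1)) / (lam j : ℂ) ^ ν = (-1) ^ (ν + 1) *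
        (Polynomial.aeval (mu j + (lam j : ℂ) * s)
        (Polynomial.bernoulli (ν + 1)) / (lam j : ℂ) ^ ν) := by
      intro j
      rw [show 1 - (lam j : ℂ) * s - mu j = 1 - (mu j + (lam j : ℂ) * s) by ring, bern_one_sub,
        mul_div_assoc]
    simp_rw [h1, bern_scaled ν _ _ _ (hl _)]
    rw [← Finset.mul_sum, Finset.sum_comm, Finset.mul_sum, Finset.mul_sum,
      ← Finset.sum_neg_distrib]
    refine Finset.sum_congr rfl fun k _ => ?_
    rw [hH, ← Finset.sum_mul, ← Finset.mul_sum]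
    ring
  simp_rw [add_div]
  rw [Finset.sum_add_distrib, hA, hB]
  simp_rw [mul_sub (Nat.cast (Nat.choose _ _) : ℂ)]
  rw [Finset.sum_sub_distrib]
  ring
end

section
/- Let θ ∈ ℝ. There exist positive constants c₀, c₁, c₂, A such that for every s = σ + it ∈ ℂ and every real v ≥ c₁|s| + c₂, writing w = -σ - c₀ + iv, one has |Γ(1 - 2s - w - iθ)| ≤ A^{|s|} · e^{-πv/2} · v^{-σ + 2c₀}. -/
open MeasureTheory Set Complex Filter Topology

lemma aux_integrable (a r : ℝ) (ha : 0 < a) (hr : 0 < r) :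
    IntegrableOn (fun t : ℝ => t ^ (a - 1) * Real.exp (-(r * t))) (Ioi 0) := by
  have := integrableOn_rpow_mul_exp_neg_mul_rpow (p := 1) (s := a - 1) (b := r) (by linarith) one_pos hr
  simpa using this

lemma aux_norm (a r : ℂ) (t : ℝ) (ht : 0 < t) :
    ‖(t : ℂ) ^ (a - 1) * cexp (-(r * t))‖ = t ^ (a.re - 1) * Real.exp (-(r.re * t)) := by
  rw [norm_mul, norm_cpow_eq_rpow_re_of_pos ht, norm_exp]; simp

lemma aux_meas (a r : ℂ) : AEStronglyMeasurable
    (fun t : ℝ => (t : ℂ) ^ (a - 1) * cexp (-(r * t))) (volume.restrict (Ioi 0)) := by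
  apply ContinuousOn.aestronglyMeasurable _ measurableSet_Ioi
  intro t ht
  apply ContinuousAt.continuousWithinAt
  apply ContinuousAt.mul
  · exact (continuousAt_ofReal_cpow_const _ _ (Or.inr (ne_of_gt ht)))
  · fun_prop

lemma aux_diff (a : ℂ) (ha : 0 < a.re) (r : ℂ) (hr : 0 < r.re) :
    DifferentiableAt ℂ (fun r : ℂ => ∫ t : ℝ in Ioi 0, (t : ℂ) ^ (a - 1) * cexp (-(r * t))) r := by
  refine (hasDerivAt_integral_of_dominated_loc_of_deriv_le (μ := volume.restrict (Ioi 0))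
    (F := fun (r : ℂ) (t : ℝ) => (t : ℂ) ^ (a - 1) * cexp (-(r * t)))
    (F' := fun (r : ℂ) (t : ℝ) => (t : ℂ) ^ (a - 1) * (cexp (-(r * t)) * (-t)))
    (bound := fun t : ℝ => t ^ ((a.re + 1) - 1) * Real.exp (-((r.re / 2) * t)))
    (s := Metric.ball r (r.re / 2))
    (Metric.ball_mem_nhds r (by linarith)) ?_ ?_ ?_ ?_ ?_ ?_).2.differentiableAt
  · exact Eventually.of_forall fun r => aux_meas a r
  · apply Integrable.mono' (aux_integrable a.re r.re ha hr) (aux_meas a r)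
    filter_upwards [ae_restrict_mem measurableSet_Ioi] with t ht
    exact (aux_norm a r t ht).le
  · have := (aux_meas a r).mul (f := fun t : ℝ => (t : ℂ) ^ (a - 1) * cexp (-(r * t)))
      (g := fun t : ℝ => -(t : ℂ)) (by
        apply Continuous.aestronglyMeasurable; fun_prop)
    refine this.congr (Eventually.of_forall fun t => ?_)
    simp only [Pi.mul_apply]; ring
  · filter_upwards [ae_restrict_mem measurableSet_Ioi] with t ht r' hr'
    have ht : 0 < t := ht
    rw [← mul_assoc, norm_mul, aux_norm a r' t ht, norm_neg, norm_real, Real.norm_of_nonneg ht.le]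
    have h1 : r.re / 2 ≤ r'.re := by
      rw [Metric.mem_ball, dist_eq] at hr'
      have := abs_re_le_norm (r' - r)
      rw [sub_re] at this
      have := (abs_le.1 this).1
      linarith
    have h2 : t ^ (a.re + 1 - 1) = t ^ (a.re - 1) * t := by
      rw [← Real.rpow_add_one ht.ne']; ring_nf
    rw [h2, mul_right_comm]
    gcongr
  · exact aux_integrable _ _ (by linarith) (by linarith)
  · filter_upwards with t r' _
    apply HasDerivAt.const_mul
    apply HasDerivAt.cexp
    have := ((hasDerivAt_id r').mul_const (t : ℂ)).neg
    rw [one_mul] at this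
    exact this

lemma aux_int (a : ℂ) (ha : 0 < a.re) (r : ℂ) (hr : 0 < r.re) :
    ∫ t : ℝ in Ioi 0, (t : ℂ) ^ (a - 1) * cexp (-(r * t)) = (1 / r) ^ a * Gamma a := by
  have hU : IsOpen {r : ℂ | 0 < r.re} := isOpen_lt continuous_const continuous_re
  have h1 : AnalyticOnNhd ℂ (fun r : ℂ => ∫ t : ℝ in Ioi 0, (t : ℂ) ^ (a - 1) * cexp (-(r * t)))
      {r : ℂ | 0 < r.re} :=
    DifferentiableOn.analyticOnNhd (fun r hr => (aux_diff a ha r hr).differentiableWithinAt) hU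
  have h2 : AnalyticOnNhd ℂ (fun r : ℂ => (1 / r) ^ a * Gamma a) {r : ℂ | 0 < r.re} := by
    refine DifferentiableOn.analyticOnNhd (fun r hr => ?_) hU
    have hr : 0 < r.re := hr
    have h0 : r ≠ 0 := by rintro rfl; simp at hr
    apply DifferentiableAt.differentiableWithinAt
    apply DifferentiableAt.mul_const
    apply DifferentiableAt.cpow_const
    · exact (differentiableAt_const _).div differentiableAt_id h0
    · left
      rw [one_div, inv_re]
      exact div_pos hr (normSq_pos.2 h0)
  refine h1.eqOn_of_preconnected_of_frequently_eq h2 (convex_halfSpace_re_gt 0).isPreconnected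
    (z₀ := 1) (by simp) ?_ hr
  have ht : Tendsto (fun x : ℝ => (x : ℂ)) (𝓝[>] 1) (𝓝[≠] 1) := by
    apply tendsto_nhdsWithin_iff.2 ⟨?_, ?_⟩
    · have : Tendsto (fun x : ℝ => (x : ℂ)) (𝓝 1) (𝓝 ((1 : ℝ) : ℂ)) :=
        continuous_ofReal.continuousAt
      simpa using this.mono_left nhdsWithin_le_nhds
    · filter_upwards [self_mem_nhdsWithin] with x hx
      have : (1 : ℝ) < x := hx
      simp only [mem_compl_iff, mem_singleton_iff]
      exact_mod_cast this.ne'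
  apply ht.frequently
  apply Eventually.frequently
  filter_upwards [self_mem_nhdsWithin] with x hx
  have : (1 : ℝ) < x := hx
  exact Complex.integral_cpow_mul_exp_neg_mul_Ioi ha (by linarith)

lemma aux_bound_s7 (a : ℂ) (ha : 0 < a.re) (r : ℂ) (hr : 0 < r.re) :
    ‖Gamma a‖ ≤ ‖r‖ ^ a.re * Real.exp (-(arg r * a.im)) * ((1 / r.re) ^ a.re * Real.Gamma a.re) := by
  have h0 : r ≠ 0 := by rintro rfl; simp at hr
  have hne : arg r ≠ Real.pi := by
    intro h
    have := (arg_lt_pi_iff (z := r)).2 (Or.inl hr.le)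
    linarith
  have h1 := aux_int a ha r hr
  have h2 : r ^ a * (1 / r) ^ a = 1 := by
    rw [one_div, inv_cpow _ _ hne, mul_inv_cancel₀]
    simp [cpow_eq_zero_iff, h0]
  have h3 : Gamma a = r ^ a * ∫ t : ℝ in Ioi 0, (t : ℂ) ^ (a - 1) * cexp (-(r * t)) := by
    rw [h1, ← mul_assoc, h2, one_mul]
  rw [h3, norm_mul, norm_cpow_of_ne_zero h0, div_eq_mul_inv, ← Real.exp_neg]
  gcongr
  rw [← Real.integral_rpow_mul_exp_neg_mul_Ioi ha hr]
  refine (norm_integral_le_integral_norm _).trans (le_of_eq ?_)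
  exact setIntegral_congr_fun measurableSet_Ioi fun t ht => aux_norm a r t ht

lemma aux_Gamma_le (n : ℕ) : ∀ x : ℝ, 1 ≤ x → x ≤ n + 2 → Real.Gamma x ≤ x ^ x := by
  induction n with
  | zero =>
    intro x h1 h2
    have hc := Real.convexOn_Gamma.2 (show (1 : ℝ) ∈ Ioi 0 by simp) (show (2 : ℝ) ∈ Ioi 0 by simp)
      (show 0 ≤ 2 - x by simp at h2; linarith) (show 0 ≤ x - 1 by linarith) (by ring)
    simp only [smul_eq_mul, Real.Gamma_one, Real.Gamma_two] at hc
    have : (2 - x) * 1 + (x - 1) * 2 = x := by ring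
    rw [this] at hc
    have := Real.one_le_rpow h1 (by linarith : 0 ≤ x)
    linarith
  | succ n ih =>
    intro x h1 h2
    by_cases h : x ≤ n + 2
    · exact ih x h1 h
    have hn : (0 : ℝ) ≤ n := n.cast_nonneg
    push_cast at h2
    push Not at h
    have h3 := ih (x - 1) (by linarith) (by linarith)
    have h4 := Real.Gamma_add_one (s := x - 1) (by linarith)
    rw [sub_add_cancel] at h4
    rw [h4]
    have h5 : (x - 1) ^ (x - 1) ≤ x ^ (x - 1) :=
      Real.rpow_le_rpow (by linarith) (by linarith) (by linarith)
    have h6 : x ^ x = x * x ^ (x - 1) := by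
      rw [Real.rpow_sub_one (by linarith)]; field_simp
    rw [h6]
    have : 0 ≤ x - 1 := by linarith
    have := h3.trans h5
    gcongr
    linarith

lemma aux_arg (y : ℝ) (hy : 0 < y) : Real.pi / 2 - y ≤ arg (y + I) := by
  have h1 : arg (y + I) ≤ Real.pi / 2 := arg_le_pi_div_two_iff.2 (Or.inl (by simp [hy.le]))
  have h2 : 0 < arg (y + I) := by
    rcases (arg_nonneg_iff (z := y + I)).2 (by simp) |>.lt_or_eq with h | h
    · exact h
    · have := (arg_eq_zero_iff.1 h.symm).2
      simp at this
  have h3 := Real.le_tan (x := Real.pi / 2 - arg (y + I)) (by linarith) (by linarith)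
  rw [Real.tan_pi_div_two_sub, tan_arg] at h3
  simp at h3
  linarith

lemma aux_pos (x T : ℝ) (hx : 1 ≤ x) (hT : x ≤ T) :
    ‖Gamma (x + T * I)‖ ≤ (2 * Real.exp 1) ^ x * T ^ x * Real.exp (-(Real.pi / 2 * T)) := by
  have hx0 : 0 < x := by linarith
  have hT0 : 0 < T := by linarith
  have hy : 0 < x / T := by positivity
  have hb := aux_bound_s7 (x + T * I) (by simpa using hx0) (((x / T : ℝ) : ℂ) + I) (by simpa using hy)
  have hre : (x + T * I : ℂ).re = x := by simp
  have him : (x + T * I : ℂ).im = T := by simp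
  have hr : (((x / T : ℝ) : ℂ) + I).re = x / T := by simp
  rw [hre, him, hr] at hb
  refine hb.trans ?_
  have hn : ‖((x / T : ℝ) : ℂ) + I‖ ≤ 2 := by
    refine (norm_add_le _ _).trans ?_
    rw [norm_real, norm_I, Real.norm_of_nonneg hy.le]
    have : x / T ≤ 1 := (div_le_one hT0).2 hT
    linarith
  obtain ⟨n, hn'⟩ := exists_nat_ge x
  have hg := aux_Gamma_le n x hx (by linarith)
  have hg0 : 0 < Real.Gamma x := Real.Gamma_pos_of_pos hx0
  have ha := aux_arg (x / T) hy
  have he : -(arg (((x / T : ℝ) : ℂ) + I) * T) ≤ x + -(Real.pi / 2 * T) := by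
    have : (Real.pi / 2 - x / T) * T ≤ arg (((x / T : ℝ) : ℂ) + I) * T := by gcongr
    have h : x / T * T = x := by field_simp
    nlinarith
  calc _ ≤ 2 ^ x * Real.exp (x + -(Real.pi / 2 * T)) * ((1 / (x / T)) ^ x * x ^ x) := by gcongr
    _ = _ := by
      rw [← Real.mul_rpow (by positivity) hx0.le, Real.exp_add,
        Real.mul_rpow zero_le_two (Real.exp_pos 1).le, ← Real.exp_mul, one_mul]
      have : 1 / (x / T) * x = T := by field_simp
      rw [this]; ring

lemma aux_neg (T : ℝ) (hT : 2 ≤ T) (n : ℕ) : ∀ x : ℝ, 1 - n ≤ x → x ≤ 2 →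
    ‖Gamma (x + T * I)‖ ≤ (2 * Real.exp 1) ^ (2 : ℝ) * T ^ x * Real.exp (-(Real.pi / 2 * T)) := by
  have he := Real.add_one_le_exp 1
  induction n with
  | zero =>
    intro x h1 h2
    simp at h1
    refine (aux_pos x T h1 (by linarith)).trans ?_
    gcongr
    linarith
  | succ n ih =>
    intro x h1 h2
    push_cast at h1
    by_cases h : 1 - n ≤ x
    · exact ih x h h2
    push Not at h
    have hn : (0 : ℝ) ≤ n := n.cast_nonneg
    have h3 := ih (x + 1) (by linarith) (by linarith)
    have hne : (x + T * I : ℂ) ≠ 0 := by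
      intro h
      have := congrArg im h
      simp at this
      linarith
    have h4 := Gamma_add_one (x + T * I) hne
    have h5 : ((x + 1 : ℝ) : ℂ) + T * I = x + T * I + 1 := by push_cast; ring
    rw [h5, h4, norm_mul, Real.rpow_add_one (by linarith)] at h3
    have h6 : T ≤ ‖(x + T * I : ℂ)‖ := by
      have := abs_im_le_norm (x + T * I : ℂ)
      simp at this
      exact (le_abs_self T).trans this
    have h7 : T * ‖Gamma (x + T * I)‖ ≤ ‖(x + T * I : ℂ)‖ * ‖Gamma (x + T * I)‖ := by gcongr
    have hT0 : 0 < T := by linarith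
    refine le_of_mul_le_mul_left (h7.trans (h3.trans (le_of_eq ?_))) hT0
    ring

lemma aux_all (x T : ℝ) (hT : 2 ≤ T) (hx : x ≤ T) :
    ‖Gamma (x + T * I)‖ ≤
      (2 * Real.exp 1) ^ (|x| + 2) * T ^ x * Real.exp (-(Real.pi / 2 * T)) := by
  have he := Real.add_one_le_exp 1
  have := abs_nonneg x
  have := le_abs_self x
  by_cases h : 1 ≤ x
  · refine (aux_pos x T h hx).trans ?_
    gcongr <;> linarith
  · obtain ⟨n, hn⟩ := exists_nat_ge (1 - x)
    refine (aux_neg T hT n x (by linarith) (by linarith)).trans ?_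
    gcongr <;> linarith

/-- Lemma 3.4: a uniform Stirling-type bound for `Γ(1 - 2s - w - iθ)` for `w` on the
vertical half-line `Re w = -σ - c₀`, `Im w = v ≥ c₁|s| + c₂`. -/
theorem stmt_7 (θ : ℝ) :
    ∃ c₀ c₁ c₂ A : ℝ, 0 < c₀ ∧ 0 < c₁ ∧ 0 < c₂ ∧ 0 < A ∧
      ∀ s : ℂ, ∀ v : ℝ, c₁ * ‖s‖ + c₂ ≤ v →
        ∀ w : ℂ, w = -(s.re : ℂ) - (c₀ : ℂ) + v * Complex.I →
          ‖Complex.Gamma (1 - 2 * s - w - (θ : ℂ) * Complex.I)‖ ≤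
            A ^ ‖s‖ * Real.exp (-(Real.pi * v) / 2) * v ^ (-s.re + 2 * c₀) := by
  set B : ℝ := 4 * Real.exp 1 with hB
  have he := Real.add_one_le_exp 1
  have hpi := Real.pi_pos
  have hB0 : 0 < B := by positivity
  set K : ℝ := B ^ (5 : ℝ) * Real.exp (Real.pi / 2 * |θ|) with hK
  have hK0 : 0 < K := by positivity
  have hθ := abs_nonneg θ
  refine ⟨2, 8, 4 * |θ| + K + 6, B * Real.exp Real.pi, by norm_num, by norm_num, by positivity,
    by positivity, ?_⟩
  rintro s v hv w rfl
  set x : ℝ := 3 - s.re with hx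
  set T : ℝ := v + 2 * s.im + θ with hTdef
  have hs := norm_nonneg s
  have hre := abs_le.1 (abs_re_le_norm s)
  have him := abs_le.1 (abs_im_le_norm s)
  have hθ' := abs_le.1 (le_refl |θ|)
  have hv0 : 0 < v := by linarith
  have hT1 : v / 2 ≤ T := by linarith
  have hT2 : T ≤ 2 * v := by linarith
  have hTp : 0 < T := by linarith
  have hxs : |x| ≤ 3 + ‖s‖ := abs_le.2 ⟨by linarith, by linarith⟩
  have hz : (1 - 2 * s - (-(s.re : ℂ) - ((2 : ℝ) : ℂ) + v * I) - (θ : ℂ) * I : ℂ)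
      = (starRingEnd ℂ) (x + T * I) := by
    apply Complex.ext
    · simp [hx]; ring
    · simp [hTdef]; ring
  rw [hz, Gamma_conj, norm_conj]
  refine (aux_all x T (by linarith) (by linarith)).trans ?_
  have hTx : T ^ x ≤ 2 ^ |x| * v ^ x := by
    rcases le_total 0 x with h | h
    · rw [abs_of_nonneg h, ← Real.mul_rpow (by norm_num) hv0.le]
      exact Real.rpow_le_rpow hTp.le hT2 h
    · rw [abs_of_nonpos h, Real.rpow_neg (by norm_num), ← Real.inv_rpow (by norm_num),
        ← Real.mul_rpow (by norm_num) hv0.le]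
      exact Real.rpow_le_rpow_of_nonpos (by linarith) (by linarith) h
  have h2 : (2 : ℝ) ^ |x| ≤ 2 ^ (|x| + 2) := by gcongr <;> linarith
  have hexp : Real.exp (-(Real.pi / 2 * T)) ≤
      Real.exp (-(Real.pi * v) / 2) * (Real.exp Real.pi ^ ‖s‖ * Real.exp (Real.pi / 2 * |θ|)) := by
    rw [← Real.exp_mul, ← Real.exp_add, ← Real.exp_add]
    apply Real.exp_le_exp.2
    have := mul_le_mul_of_nonneg_left (show v - 2 * ‖s‖ - |θ| ≤ T by linarith)
      (show 0 ≤ Real.pi / 2 by positivity)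
    linarith
  have hvx : v ^ x * v = v ^ (-s.re + 2 * 2) := by
    rw [← Real.rpow_add_one hv0.ne']; congr 1; simp [hx]; ring
  calc (2 * Real.exp 1) ^ (|x| + 2) * T ^ x * Real.exp (-(Real.pi / 2 * T))
      ≤ (2 * Real.exp 1) ^ (|x| + 2) * (2 ^ (|x| + 2) * v ^ x) *
        (Real.exp (-(Real.pi * v) / 2) *
          (Real.exp Real.pi ^ ‖s‖ * Real.exp (Real.pi / 2 * |θ|))) := by
        gcongr
        exact hTx.trans (by gcongr)
    _ = B ^ (|x| + 2) * v ^ x * (Real.exp (-(Real.pi * v) / 2) *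
          (Real.exp Real.pi ^ ‖s‖ * Real.exp (Real.pi / 2 * |θ|))) := by
        have : B = 2 * Real.exp 1 * 2 := by rw [hB]; ring
        rw [this, Real.mul_rpow (by positivity : 0 ≤ 2 * Real.exp 1) zero_le_two]
        ring
    _ ≤ B ^ (‖s‖ + 5) * v ^ x * (Real.exp (-(Real.pi * v) / 2) *
          (Real.exp Real.pi ^ ‖s‖ * Real.exp (Real.pi / 2 * |θ|))) := by
        have : B ^ (|x| + 2) ≤ B ^ (‖s‖ + 5) :=
          Real.rpow_le_rpow_of_exponent_le (by linarith) (by linarith)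
        gcongr
    _ = (B * Real.exp Real.pi) ^ ‖s‖ * Real.exp (-(Real.pi * v) / 2) * (v ^ x * K) := by
        rw [Real.rpow_add hB0, Real.mul_rpow hB0.le (by positivity), hK]; ring
    _ ≤ (B * Real.exp Real.pi) ^ ‖s‖ * Real.exp (-(Real.pi * v) / 2) * (v ^ x * v) := by
        gcongr; linarith
    _ = _ := by rw [hvx]
end

section
/- There exists an absolute constant C > 0 such that for every integer ν ≥ 1, every real D with 0 < D < 2π, and every s ∈ ℂ, the value of the ν-th Bernoulli polynomial satisfies |B_ν(s)| ≤ C · ν! · e^{D|s|} / ((2π - D) D^ν). In particular, there is an absolute constant C' > 0 with |B_ν(s)| ≤ C' e^{|s|} ν! for all ν ≥ 1 and s ∈ ℂ. -/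
lemma bern_bound (k : ℕ) : |((bernoulli k : ℚ) : ℝ)| / (Nat.factorial k) ≤ 4 / (2 * Real.pi) ^ k := by
  have hpi := Real.pi_pos
  have hpi3 := Real.pi_gt_three
  have hpi4 := Real.pi_le_four
  rcases Nat.even_or_odd' k with ⟨m, rfl | rfl⟩
  · rcases Nat.eq_zero_or_pos m with rfl | hm
    · simp
    · have h1 := hasSum_zeta_nat (k := m) hm.ne'
      have hle := hasSum_le (fun n : ℕ => (by
        rcases Nat.eq_zero_or_pos n with rfl | hn
        · simp [hm.ne']
        · have : (1 : ℝ) ≤ n := by exact_mod_cast hn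
          gcongr
          lia : (1 : ℝ) / (n : ℝ) ^ (2 * m) ≤ 1 / (n : ℝ) ^ 2)) h1 hasSum_zeta_two
      have hnn := h1.nonneg (fun n => by positivity)
      have habs : (-1 : ℝ) ^ (m + 1) * 2 ^ (2 * m - 1) * Real.pi ^ (2 * m) *
          (bernoulli (2 * m) : ℚ) / (Nat.factorial (2 * m)) =
          2 ^ (2 * m - 1) * Real.pi ^ (2 * m) *
            (|((bernoulli (2 * m) : ℚ) : ℝ)| / (Nat.factorial (2 * m))) := by
        rw [← abs_of_nonneg hnn]
        simp [abs_mul, abs_div, abs_of_pos hpi]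
        ring
      rw [habs] at hle
      have h2 : (2 : ℝ) ^ (2 * m) = 2 * 2 ^ (2 * m - 1) := by
        rw [← pow_succ']; congr 1; lia
      rw [le_div_iff₀ (by positivity), mul_pow, h2]
      have hp : Real.pi < 3.15 := Real.pi_lt_d2
      nlinarith
  · rcases Nat.eq_zero_or_pos m with rfl | hm
    · simp [abs_div]
      rw [le_div_iff₀ (by positivity)]
      linarith
    · rw [bernoulli_eq_zero_of_odd (by simp) (by lia)]
      simp
      positivity

lemma main_bound (ν : ℕ) (D : ℝ) (hD : 0 < D) (hD2 : D < 2 * Real.pi) (s : ℂ) :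
    ‖Polynomial.aeval s (Polynomial.bernoulli ν)‖ ≤
        (8 * Real.pi) * (Nat.factorial ν) * Real.exp (D * ‖s‖) /
          ((2 * Real.pi - D) * D ^ ν) := by
  have hpi := Real.pi_pos
  have hsub : 0 < 2 * Real.pi - D := by linarith
  set r := D / (2 * Real.pi) with hr
  have hr0 : 0 ≤ r := by positivity
  have hr1 : r < 1 := by rw [hr, div_lt_one (by positivity)]; exact hD2
  have hgeom : ∑ i ∈ Finset.range (ν + 1), r ^ i ≤ 2 * Real.pi / (2 * Real.pi - D) := by
    have h := (summable_geometric_of_lt_one hr0 hr1).sum_le_tsum (Finset.range (ν + 1))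
      (fun i _ => by positivity)
    rw [tsum_geometric_of_lt_one hr0 hr1] at h
    refine h.trans (le_of_eq ?_)
    rw [hr]
    field_simp
  have hterm : ∀ i ∈ Finset.range (ν + 1),
      ‖Polynomial.aeval s (Polynomial.monomial (ν - i) (bernoulli i * (ν.choose i : ℚ)))‖ ≤
        (4 * (Nat.factorial ν) * Real.exp (D * ‖s‖) / D ^ ν) * r ^ i := by
    intro i hi
    have hi : i ≤ ν := by simpa [Nat.lt_succ_iff] using hi
    have hb := bern_bound i
    have he := Real.pow_div_factorial_le_exp (D * ‖s‖) (by positivity) (ν - i)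
    have hch : (ν.choose i : ℝ) = (Nat.factorial ν) / ((Nat.factorial i) * (Nat.factorial (ν - i))) :=
      Nat.cast_choose ℝ hi
    have hn : ‖Polynomial.aeval s (Polynomial.monomial (ν - i) (bernoulli i * (ν.choose i : ℚ)))‖
        = |((bernoulli i : ℚ) : ℝ)| * (ν.choose i : ℝ) * ‖s‖ ^ (ν - i) := by
      rw [Polynomial.aeval_monomial]
      have : ‖((bernoulli i : ℚ) : ℂ)‖ = |((bernoulli i : ℚ) : ℝ)| := by
        rw [← Complex.ofReal_ratCast, Complex.norm_real, Real.norm_eq_abs]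
      simp [this]
    have hDp : D ^ ν = D ^ i * D ^ (ν - i) := by rw [← pow_add]; congr 1; lia
    rw [hn, hch]
    calc _ = (|((bernoulli i : ℚ) : ℝ)| / (Nat.factorial i)) *
          ((D * ‖s‖) ^ (ν - i) / (Nat.factorial (ν - i))) * ((Nat.factorial ν) / D ^ (ν - i)) := by
          rw [mul_pow]; field_simp
      _ ≤ (4 / (2 * Real.pi) ^ i) * Real.exp (D * ‖s‖) * ((Nat.factorial ν) / D ^ (ν - i)) := by
          gcongr
      _ = _ := by
          rw [hDp, hr, div_pow]; field_simp
  rw [Polynomial.bernoulli, map_sum]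
  refine (norm_sum_le_of_le _ hterm).trans ?_
  rw [← Finset.mul_sum]
  refine (mul_le_mul_of_nonneg_left hgeom (by positivity)).trans (le_of_eq ?_)
  field_simp
  ring



/-- Lemma 3.5: `|B_ν(s)| ≤ C ν! e^{D|s|}/((2π - D) D^ν)` for `0 < D < 2π`, and in
particular `|B_ν(s)| ≤ C' e^{|s|} ν!`, where `B_ν` is the `ν`-th Bernoulli polynomial. -/
theorem stmt_8 :
    (∃ C : ℝ, 0 < C ∧ ∀ ν : ℕ, 1 ≤ ν → ∀ D : ℝ, 0 < D → D < 2 * Real.pi → ∀ s : ℂ,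
      ‖Polynomial.aeval s (Polynomial.bernoulli ν)‖ ≤
        C * (Nat.factorial ν) * Real.exp (D * ‖s‖) /
          ((2 * Real.pi - D) * D ^ ν)) ∧
    (∃ C' : ℝ, 0 < C' ∧ ∀ ν : ℕ, 1 ≤ ν → ∀ s : ℂ,
      ‖Polynomial.aeval s (Polynomial.bernoulli ν)‖ ≤
        C' * Real.exp (‖s‖) * (Nat.factorial ν)) := by

  have hpi := Real.pi_pos
  have hpi3 := Real.pi_gt_three
  refine ⟨⟨8 * Real.pi, by positivity, fun ν _ D h1 h2 s => main_bound ν D h1 h2 s⟩,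
    8 * Real.pi / (2 * Real.pi - 1), div_pos (by positivity) (by linarith), fun ν _ s => ?_⟩
  refine (main_bound ν 1 one_pos (by linarith) s).trans (le_of_eq ?_)
  rw [one_pow, one_mul, mul_one]
  ring
end

section
/- For every real x > 0 and every integer N with 1 ≤ N ≤ (3/2)x, one has Σ_{m=1}^{N} x^m/m! ≤ (2x)^N/N!. -/
/-- Lemma 3.6: `Σ_{m=1}^N x^m/m! ≤ (2x)^N/N!` for `1 ≤ N ≤ (3/2)x`. -/
theorem stmt_9 (x : ℝ) (hx : 0 < x) (N : ℕ) (hN : 1 ≤ N) (hN2 : (N : ℝ) ≤ 3 / 2 * x) :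
    ∑ m ∈ Finset.Icc 1 N, x ^ m / (Nat.factorial m) ≤ (2 * x) ^ N / (Nat.factorial N) := by
  induction N, hN using Nat.le_induction with
  | base => simp; linarith
  | succ n hn ih =>
    push_cast at hN2
    have ih' := ih (by linarith)
    rw [Finset.sum_Icc_succ_top (by omega)]
    refine (add_le_add_left ih' _).trans ?_
    have hf : (0 : ℝ) < (Nat.factorial n : ℝ) := by positivity
    have h2 : (2 : ℝ) ≤ 2 ^ n := by
      calc (2 : ℝ) = 2 ^ 1 := by norm_num
        _ ≤ 2 ^ n := pow_le_pow_right₀ (by norm_num) hn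
    have key : (2 : ℝ) ^ n * (n + 1) + x ≤ 2 * 2 ^ n * x := by
      have h3 := mul_le_mul_of_nonneg_left hN2 (by positivity : (0 : ℝ) ≤ 2 ^ n)
      nlinarith
    have hk := mul_le_mul_of_nonneg_left key (by positivity : (0 : ℝ) ≤ x ^ n)
    have e : (2 * x) ^ n / (Nat.factorial n : ℝ)
        = (x ^ n * (2 ^ n * (n + 1))) / (Nat.factorial (n + 1) : ℝ) := by
      rw [Nat.factorial_succ, mul_pow]
      push_cast
      field_simp
    rw [e, ← add_div]
    apply div_le_div_of_nonneg_right _ (by positivity)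
    rw [mul_pow, pow_succ, pow_succ]
    nlinarith
end

section
/- Let r ≥ 1, λ_1,…,λ_r > 0, μ_1,…,μ_r ∈ ℂ, and let θ be the imaginary part of 2 Σ_{j=1}^r (μ_j - 1/2). For ν ≥ 1 define R_ν(s) = B_{ν+1}(1 - 2s - iθ) + B_{ν+1}(1) - Σ_{j=1}^r ( B_{ν+1}(λ_j(1-s) + conj(μ_j)) + B_{ν+1}(1 - λ_j s - μ_j) ) / λ_j^ν, where B_n is the n-th Bernoulli polynomial. Then for every real c ≥ 1 there exists c' > 0 such that for all s ∈ ℂ and all integers ν with 1 ≤ ν ≤ c(|s| + 1), one has |R_ν(s)| ≤ (c'(|s| + 1))^{ν+1}. -/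
open Finset in
lemma bern_aux (N : ℕ) (hN : 1 ≤ N) : ∀ n : ℕ, n ≤ N → |bernoulli' n| ≤ (2 * (N : ℚ)) ^ n := by
  intro n
  induction n using Nat.strong_induction_on with
  | _ n ih =>
    intro hn
    have hN' : (1 : ℚ) ≤ N := by exact_mod_cast hN
    rw [bernoulli'_def]
    have hsum : |∑ k ∈ range n, (n.choose k : ℚ) / (n - k + 1) * bernoulli' k|
        ≤ ∑ k ∈ range n, (N : ℚ) ^ n * 2 ^ k / 2 := by
      refine (abs_sum_le_sum_abs _ _).trans (sum_le_sum fun k hk => ?_)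
      have hk' : k < n := mem_range.1 hk
      have hkq : (k : ℚ) + 1 ≤ n := by exact_mod_cast hk'
      have h1 := ih k hk' (by omega)
      have h2 : (n.choose k : ℚ) ≤ (N : ℚ) ^ (n - k) := by
        rw [← Nat.choose_symm hk'.le]
        have := Nat.choose_le_pow n (n - k)
        have h3 : n ^ (n - k) ≤ N ^ (n - k) := Nat.pow_le_pow_left hn _
        exact_mod_cast this.trans h3
      have h4 : |(n.choose k : ℚ) / (n - k + 1)| ≤ (N : ℚ) ^ (n - k) / 2 := by
        rw [abs_of_nonneg (div_nonneg (by positivity) (by linarith))]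
        exact div_le_div₀ (by positivity) h2 (by norm_num) (by linarith)
      rw [abs_mul]
      calc _ ≤ (N : ℚ) ^ (n - k) / 2 * (2 * (N : ℚ)) ^ k :=
            mul_le_mul h4 h1 (abs_nonneg _) (by positivity)
        _ = (N : ℚ) ^ (n - k + k) * 2 ^ k / 2 := by rw [mul_pow, pow_add]; ring
        _ = _ := by rw [Nat.sub_add_cancel hk'.le]
    have hgeom : ∑ k ∈ range n, (N : ℚ) ^ n * 2 ^ k / 2 = (N : ℚ) ^ n * (2 ^ n - 1) / 2 := by
      rw [← sum_div, ← mul_sum, geom_sum_eq (by norm_num)]; norm_num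
    rw [hgeom] at hsum
    have h5 : (1 : ℚ) ≤ (N : ℚ) ^ n := one_le_pow₀ hN'
    have h6 : (1 : ℚ) ≤ 2 ^ n := one_le_pow₀ (by norm_num)
    have h7 := abs_sub (1 : ℚ) (∑ k ∈ range n, (n.choose k : ℚ) / (n - k + 1) * bernoulli' k)
    rw [mul_pow]
    rw [abs_one] at h7
    nlinarith

open Finset in
lemma bern_poly (n : ℕ) (hn : 1 ≤ n) (x : ℂ) :
    ‖Polynomial.aeval x (Polynomial.bernoulli n)‖ ≤ (‖x‖ + 2 * n) ^ n := by
  rw [Polynomial.bernoulli, map_sum, add_comm ‖x‖, add_pow]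
  refine (norm_sum_le _ _).trans (sum_le_sum fun k hk => ?_)
  have hk' : k ≤ n := by have := mem_range.1 hk; omega
  rw [Polynomial.aeval_monomial, norm_mul, norm_pow]
  have h1 : ‖(algebraMap ℚ ℂ) (bernoulli k * (n.choose k))‖
      ≤ (2 * (n : ℝ)) ^ k * n.choose k := by
    have h2 := bern_aux n hn k hk'
    have h3 : |bernoulli k| ≤ (2 * (n : ℚ)) ^ k := by
      rw [bernoulli, abs_mul, abs_pow]; simpa using h2
    have h4 : ((|bernoulli k| : ℚ) : ℝ) ≤ (2 * (n : ℝ)) ^ k := by exact_mod_cast h3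
    rw [map_mul, norm_mul]
    simp only [eq_ratCast, Rat.cast_natCast, Complex.norm_ratCast, Complex.norm_natCast]
    push_cast at h4
    gcongr
  calc _ ≤ (2 * (n : ℝ)) ^ k * n.choose k * ‖x‖ ^ (n - k) := by gcongr
    _ = _ := by ring

/-- Lemma 3.8: polynomial-growth bound `|R_ν(s)| ≤ (c'(|s|+1))^{ν+1}` for the polynomials
`R_ν(s)` attached to functional-equation data, in the range `ν ≤ c(|s|+1)`. -/
theorem stmt_11
    (r : ℕ) (hr : 1 ≤ r) (lam : Fin r → ℝ) (hlam : ∀ j, 0 < lam j)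
    (mu : Fin r → ℂ) (θ : ℝ) (hθ : θ = (2 * ∑ j, (mu j - 1 / 2)).im)
    (R : ℕ → ℂ → ℂ)
    (hR : ∀ (ν : ℕ) (s : ℂ), R ν s =
      Polynomial.aeval (1 - 2 * s - (θ : ℂ) * Complex.I) (Polynomial.bernoulli (ν + 1)) +
        Polynomial.aeval (1 : ℂ) (Polynomial.bernoulli (ν + 1)) -
        ∑ j, (Polynomial.aeval ((lam j : ℂ) * (1 - s) + (starRingEnd ℂ) (mu j))
              (Polynomial.bernoulli (ν + 1)) +
            Polynomial.aeval (1 - (lam j : ℂ) * s - mu j) (Polynomial.bernoulli (ν + 1))) /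
          (lam j : ℂ) ^ ν)
    (c : ℝ) (hc : 1 ≤ c) :
    ∃ c' : ℝ, 0 < c' ∧ ∀ s : ℂ, ∀ ν : ℕ, 1 ≤ ν → (ν : ℝ) ≤ c * (‖s‖ + 1) →
      ‖R ν s‖ ≤ (c' * (‖s‖ + 1)) ^ (ν + 1) := by
  classical
  set Λ : ℝ := ∑ j, lam j with hΛ
  set L : ℝ := 1 + ∑ j, (lam j)⁻¹ with hL
  set M : ℝ := ∑ j, ‖mu j‖ with hM
  have hΛj : ∀ j, lam j ≤ Λ := fun j =>
    Finset.single_le_sum (f := lam) (fun i _ => (hlam i).le) (Finset.mem_univ j)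
  have hLj : ∀ j, (lam j)⁻¹ ≤ L := fun j => by
    have := Finset.single_le_sum (f := fun j => (lam j)⁻¹)
      (fun i _ => (inv_pos.2 (hlam i)).le) (Finset.mem_univ j)
    linarith
  have hMj : ∀ j, ‖mu j‖ ≤ M := fun j =>
    Finset.single_le_sum (f := fun j => ‖mu j‖) (fun i _ => norm_nonneg _) (Finset.mem_univ j)
  have hΛ0 : 0 ≤ Λ := Finset.sum_nonneg fun i _ => (hlam i).le
  have hM0 : 0 ≤ M := Finset.sum_nonneg fun i _ => norm_nonneg _
  have hL1 : 1 ≤ L := by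
    have : 0 ≤ ∑ j, (lam j)⁻¹ := Finset.sum_nonneg fun i _ => (inv_pos.2 (hlam i)).le
    linarith
  set D : ℝ := 2 + |θ| + Λ + M with hD
  have hθ0 := abs_nonneg θ
  have hD0 : 0 < D := by positivity
  refine ⟨(2 + 2 * Λ) * L * (D + 4 * c), by positivity, fun s ν hν hνc => ?_⟩
  set T : ℝ := ‖s‖ + 1 with hT
  have hs0 := norm_nonneg s
  have hT1 : 1 ≤ T := by linarith
  have key : ∀ x : ℂ, ‖x‖ ≤ D * T →
      ‖Polynomial.aeval x (Polynomial.bernoulli (ν + 1))‖ ≤ ((D + 4 * c) * T) ^ (ν + 1) := by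
    intro x hx
    refine (bern_poly (ν + 1) (by omega) x).trans ?_
    refine pow_le_pow_left₀ (by positivity) ?_ _
    push_cast
    nlinarith
  have k1 := key (1 - 2 * s - (θ : ℂ) * Complex.I) (by
    have h1 := norm_sub_le (1 - 2 * s) ((θ : ℂ) * Complex.I)
    have h2 := norm_sub_le (1 : ℂ) (2 * s)
    rw [norm_mul, Complex.norm_real, Complex.norm_I, mul_one, Real.norm_eq_abs] at h1
    rw [norm_mul, norm_one, Complex.norm_ofNat] at h2
    nlinarith)
  have k2 := key 1 (by rw [norm_one]; nlinarith)
  have k3 : ∀ j, _ := fun j => key ((lam j : ℂ) * (1 - s) + (starRingEnd ℂ) (mu j)) (by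
    have h1 := norm_add_le ((lam j : ℂ) * (1 - s)) ((starRingEnd ℂ) (mu j))
    have h2 := norm_sub_le (1 : ℂ) s
    rw [norm_mul, Complex.norm_real, Real.norm_of_nonneg (hlam j).le, RCLike.norm_conj] at h1
    rw [norm_one] at h2
    have h3 := hΛj j
    have h4 := hMj j
    have h5 := hlam j
    have h6 : lam j * ‖1 - s‖ ≤ Λ * T := mul_le_mul h3 (by linarith) (norm_nonneg _) hΛ0
    nlinarith)
  have k4 : ∀ j, _ := fun j => key (1 - (lam j : ℂ) * s - mu j) (by
    have h1 := norm_sub_le (1 - (lam j : ℂ) * s) (mu j)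
    have h2 := norm_sub_le (1 : ℂ) ((lam j : ℂ) * s)
    rw [norm_mul, Complex.norm_real, Real.norm_of_nonneg (hlam j).le, norm_one] at h2
    have h3 := hΛj j
    have h4 := hMj j
    have h6 : lam j * ‖s‖ ≤ Λ * T := mul_le_mul h3 (by linarith) (norm_nonneg _) hΛ0
    nlinarith)
  set P : ℝ := ((D + 4 * c) * T) ^ (ν + 1) with hP
  have hP0 : 0 ≤ P := by positivity
  have hLn : 1 ≤ L ^ (ν + 1) := one_le_pow₀ hL1
  rw [hR]
  have hsum : ‖∑ j, (Polynomial.aeval ((lam j : ℂ) * (1 - s) + (starRingEnd ℂ) (mu j))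
              (Polynomial.bernoulli (ν + 1)) +
            Polynomial.aeval (1 - (lam j : ℂ) * s - mu j) (Polynomial.bernoulli (ν + 1))) /
          (lam j : ℂ) ^ ν‖ ≤ ∑ j, lam j * (2 * P * L ^ (ν + 1)) := by
    refine (norm_sum_le _ _).trans (Finset.sum_le_sum fun j _ => ?_)
    have hl := hlam j
    rw [norm_div, norm_pow, Complex.norm_real, Real.norm_of_nonneg hl.le]
    have e : ∀ y : ℝ, y / lam j ^ ν = lam j * (y * (lam j)⁻¹ ^ (ν + 1)) := by
      intro y; rw [inv_pow]; field_simp; ring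
    rw [e]
    have h1 := (norm_add_le _ _).trans (add_le_add (k3 j) (k4 j))
    have h2 : (lam j)⁻¹ ^ (ν + 1) ≤ L ^ (ν + 1) :=
      pow_le_pow_left₀ (inv_pos.2 hl).le (hLj j) _
    refine mul_le_mul_of_nonneg_left ?_ hl.le
    exact mul_le_mul (by linarith) h2 (by positivity) (by positivity)
  rw [← Finset.sum_mul, ← hΛ] at hsum
  have hfin : P + P + Λ * (2 * P * L ^ (ν + 1)) ≤ (2 + 2 * Λ) * L ^ (ν + 1) * P := by
    nlinarith
  have hA : 2 + 2 * Λ ≤ (2 + 2 * Λ) ^ (ν + 1) := le_self_pow₀ (by linarith) (by omega)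
  calc _ ≤ P + P + Λ * (2 * P * L ^ (ν + 1)) :=
        (norm_sub_le _ _).trans (add_le_add ((norm_add_le _ _).trans (add_le_add k1 k2)) hsum)
    _ ≤ (2 + 2 * Λ) * L ^ (ν + 1) * P := hfin
    _ ≤ (2 + 2 * Λ) ^ (ν + 1) * L ^ (ν + 1) * P := by gcongr
    _ = _ := by rw [hP, ← mul_pow, ← mul_pow]; congr 1; ring
end

section
/- Let w ∈ ℂ and let m, M be integers with 1 ≤ m + 1 ≤ M < |w|. Then | 1/w − ((-1)^{m+1}/m!) Σ_{ℓ=m+1}^{M} (-1)^ℓ (ℓ-1)! / ((w-(m+1))(w-(m+2))⋯(w-ℓ)) | ≤ M! / ( m! · |w| · |w-(m+1)| · |w-(m+2)| ⋯ |w-M| ). -/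
lemma aux_identity (w : ℂ) (m k : ℕ) (hw : w ≠ 0)
    (h : ∀ j : ℕ, j ≤ m + k → w - (j : ℂ) ≠ 0) :
    (1 / w -
        (-1 : ℂ) ^ (m + 1) / (Nat.factorial m) *
          ∑ ℓ ∈ Finset.Icc (m + 1) (m + k),
            (-1 : ℂ) ^ ℓ * (Nat.factorial (ℓ - 1)) / ∏ j ∈ Finset.Icc (m + 1) ℓ, (w - j) : ℂ) =
      (-1 : ℂ) ^ k * (Nat.factorial (m + k)) /
        ((Nat.factorial m) * w * ∏ j ∈ Finset.Icc (m + 1) (m + k), (w - j)) := by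
  have hm : (Nat.factorial m : ℂ) ≠ 0 := by exact_mod_cast Nat.factorial_ne_zero m
  induction k with
  | zero =>
    simp
    field_simp
  | succ k ih =>
    have ih := ih (fun j hj => h j (by omega))
    have hP : ∏ j ∈ Finset.Icc (m + 1) (m + k), (w - (j : ℂ)) ≠ 0 := by
      refine Finset.prod_ne_zero_iff.mpr fun j hj => h j ?_
      have := (Finset.mem_Icc.mp hj).2
      omega
    have hl := h (m + k + 1) (by omega)
    have hs : (-1 : ℂ) ^ (m + 1) * (-1) ^ (m + k + 1) = (-1) ^ k := by
      rw [← pow_add, show m + 1 + (m + k + 1) = 2 * (m + 1) + k by ring, pow_add, pow_mul]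
      simp
    rw [← add_assoc, Finset.sum_Icc_succ_top (by omega), mul_add, ← sub_sub, ih,
      Finset.prod_Icc_succ_top (by omega), Nat.factorial_succ, Nat.add_sub_cancel]
    generalize ∏ j ∈ Finset.Icc (m + 1) (m + k), (w - (j : ℂ)) = P at *
    have e : (-1 : ℂ) ^ (m + 1) / (Nat.factorial m) *
        ((-1) ^ (m + k + 1) * (Nat.factorial (m + k)) / (P * (w - ((m + k + 1 : ℕ) : ℂ)))) =
        (-1) ^ k * (Nat.factorial (m + k)) /
          (Nat.factorial m * (P * (w - ((m + k + 1 : ℕ) : ℂ)))) := by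
      rw [← hs, div_mul_div_comm]
      rw [mul_assoc]
    rw [e, pow_succ, Nat.cast_mul]
    generalize ((m + k + 1 : ℕ) : ℂ) = c at *
    field_simp
    ring

/-- Lemma 3.10: partial-fraction type expansion of `1/w` with an explicit remainder bound. -/
theorem stmt_12 (w : ℂ) (m M : ℕ) (h1 : m + 1 ≤ M) (h2 : (M : ℝ) < ‖w‖) :
    ‖(1 / w -
        (-1 : ℂ) ^ (m + 1) / (Nat.factorial m) *
          ∑ ℓ ∈ Finset.Icc (m + 1) M,
            (-1 : ℂ) ^ ℓ * (Nat.factorial (ℓ - 1)) / ∏ j ∈ Finset.Icc (m + 1) ℓ, (w - j) : ℂ)‖ ≤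
      (Nat.factorial M) /
        ((Nat.factorial m) * ‖w‖ *
          ∏ j ∈ Finset.Icc (m + 1) M, ‖w - j‖) := by
  obtain ⟨k, rfl⟩ := Nat.exists_eq_add_of_le (show m ≤ M by omega)
  have h : ∀ j : ℕ, j ≤ m + k → w - (j : ℂ) ≠ 0 := by
    intro j hj h0
    rw [sub_eq_zero.mp h0, Complex.norm_natCast] at h2
    have : m + k < j := by exact_mod_cast h2
    omega
  have hw : w ≠ 0 := by simpa using h 0 (by omega)
  rw [aux_identity w m k hw h]
  simp [norm_prod]
end

section
/- Define complex numbers C_{μ,ℓ} for integers ℓ ≥ μ ≥ 1 by C_{1,ℓ} = (-1)^{ℓ-1}(ℓ-1)! and, for ℓ ≥ μ+1 ≥ 2, C_{μ+1,ℓ} = (-1)^{ℓ-1}(ℓ-1)! Σ_{m=μ}^{ℓ-1} (-1)^m C_{μ,m}/m!. Then: (a) for all ℓ ≥ μ ≥ 2, C_{μ,ℓ} = (-1)^{ℓ-μ}(ℓ-1)! Σ_{1 ≤ k_1 < k_2 < ⋯ < k_{μ-1} ≤ ℓ-1} 1/(k_1 k_2 ⋯ k_{μ-1}); and (b) for all ℓ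 ≥ μ ≥ 1, |C_{μ,ℓ}| ≤ ((ℓ-1)!/(μ-1)!) · binom(ℓ-1, μ-1). -/
/-- The elementary symmetric sums of `1, 1/2, …, 1/n`. -/
noncomputable def symE (n j : ℕ) : ℝ :=
  ∑ T ∈ Finset.powersetCard j (Finset.Icc 1 n), (∏ k ∈ T, (k : ℝ))⁻¹

lemma symE_zero (n : ℕ) : symE n 0 = 1 := by simp [symE]

lemma symE_lt (n j : ℕ) (h : n < j) : symE n j = 0 := by
  unfold symE
  rw [Finset.powersetCard_eq_empty.2 (by simpa using h)]
  simp

lemma symE_succ (n j : ℕ) : symE (n + 1) (j + 1) = symE n (j + 1) + symE n j / (n + 1) := by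
  unfold symE
  have hI : Finset.Icc 1 (n + 1) = insert (n + 1) (Finset.Icc 1 n) := by
    ext x; simp; omega
  have hn : n + 1 ∉ Finset.Icc 1 n := by simp
  have hmem : ∀ i, ∀ T ∈ Finset.powersetCard i (Finset.Icc 1 n), n + 1 ∉ T := by
    intro i T hT hc
    exact hn ((Finset.mem_powersetCard.1 hT).1 hc)
  rw [hI, Finset.powersetCard_succ_insert hn, Finset.sum_union, Finset.sum_image]
  · congr 1
    rw [Finset.sum_div]
    refine Finset.sum_congr rfl fun T hT => ?_
    rw [Finset.prod_insert (hmem _ T hT), mul_inv, div_eq_mul_inv, mul_comm]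
    push_cast
    rfl
  · intro S hS T hT h
    have h2 := congrArg (fun U => Finset.erase U (n + 1)) h
    simpa [Finset.erase_insert (hmem _ S hS), Finset.erase_insert (hmem _ T hT)] using h2
  · rw [Finset.disjoint_left]
    intro T hT hT2
    obtain ⟨S, -, rfl⟩ := Finset.mem_image.1 hT2
    exact hmem _ _ hT (Finset.mem_insert_self _ _)

lemma symE_nonneg (n j : ℕ) : 0 ≤ symE n j :=
  Finset.sum_nonneg fun T _ => by positivity

lemma symE_le (n j : ℕ) : symE n j ≤ (n.choose j : ℝ) / j.factorial := by
  induction n generalizing j with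
  | zero =>
    cases j with
    | zero => simp [symE_zero]
    | succ j => rw [symE_lt _ _ (by omega)]; positivity
  | succ n ih =>
    cases j with
    | zero => simp [symE_zero]
    | succ j =>
      rw [symE_succ, Nat.choose_succ_succ, Nat.cast_add, add_comm (n.choose j : ℝ), add_div]
      refine add_le_add (ih _) ?_
      rcases le_or_gt j n with h | h
      · have h1 : ((j : ℝ) + 1) ≤ n + 1 := by exact_mod_cast Nat.succ_le_succ h
        calc symE n j / (n + 1) ≤ ((n.choose j : ℝ) / j.factorial) / (j + 1) := by
              have := ih j
              gcongr
          _ = _ := by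
              rw [Nat.factorial_succ, div_div]; push_cast; rw [mul_comm ((j : ℝ) + 1)]
      · rw [symE_lt _ _ h]; simp; positivity

lemma symE_sum (j n : ℕ) (h : j ≤ n) :
    ∑ m ∈ Finset.Icc (j + 1) n, symE (m - 1) j / m = symE n (j + 1) := by
  induction n, h using Nat.le_induction with
  | base => simp [symE_lt]
  | succ n h ih =>
    rw [Finset.sum_Icc_succ_top (by omega), ih, symE_succ]
    simp

lemma coeff_formula (C : ℕ → ℕ → ℂ)
    (hC1 : ∀ ℓ : ℕ, 1 ≤ ℓ → C 1 ℓ = (-1 : ℂ) ^ (ℓ - 1) * (Nat.factorial (ℓ - 1)))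
    (hCrec : ∀ μ ℓ : ℕ, 1 ≤ μ → μ + 1 ≤ ℓ →
      C (μ + 1) ℓ = (-1 : ℂ) ^ (ℓ - 1) * (Nat.factorial (ℓ - 1)) *
        ∑ m ∈ Finset.Icc μ (ℓ - 1), (-1 : ℂ) ^ m * C μ m / (Nat.factorial m))
    (j n : ℕ) (h : j ≤ n) :
    C (j + 1) (n + 1) = (-1 : ℂ) ^ (n + j) * n.factorial * (symE n j : ℂ) := by
  induction j generalizing n with
  | zero => rw [hC1 _ (by omega)]; simp [symE_zero]
  | succ j ih =>
    rw [hCrec (j + 1) (n + 1) (by omega) (by omega), ← symE_sum j n (by omega)]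
    have : ∑ m ∈ Finset.Icc (j + 1) (n + 1 - 1), (-1 : ℂ) ^ m * C (j + 1) m / (m.factorial)
        = (-1) ^ (j + 1) * ∑ m ∈ Finset.Icc (j + 1) n, ((symE (m - 1) j / m : ℝ) : ℂ) := by
      rw [Finset.mul_sum]
      refine Finset.sum_congr rfl fun m hm => ?_
      obtain ⟨k, rfl⟩ : ∃ k, m = k + 1 := ⟨m - 1, by simp at hm; omega⟩
      rw [ih k (by simp at hm; omega), Nat.factorial_succ]
      have h1 : (k.factorial : ℂ) ≠ 0 := by exact_mod_cast k.factorial_ne_zero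
      have h2 : (k : ℂ) + 1 ≠ 0 := by exact_mod_cast k.succ_ne_zero
      have h3 : (-1 : ℂ) ^ k * (-1) ^ k = 1 := by rw [← mul_pow]; simp
      push_cast
      field_simp
      linear_combination (-(-1 : ℂ) ^ j * (symE k j : ℂ)) * h3
    rw [this]
    push_cast
    ring


/-- Lemma 3.12 (with the recurrence of Lemma 3.11): the coefficients `C_{μ,ℓ}` of the
asymptotic expansion `1/w^μ ≈ Σ_ℓ C_{μ,ℓ}/((w-1)⋯(w-ℓ))` are given by an explicit
elementary-symmetric-type formula and satisfy an explicit factorial bound. -/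
theorem stmt_13 (C : ℕ → ℕ → ℂ)
    (hC1 : ∀ ℓ : ℕ, 1 ≤ ℓ → C 1 ℓ = (-1 : ℂ) ^ (ℓ - 1) * (Nat.factorial (ℓ - 1)))
    (hCrec : ∀ μ ℓ : ℕ, 1 ≤ μ → μ + 1 ≤ ℓ →
      C (μ + 1) ℓ = (-1 : ℂ) ^ (ℓ - 1) * (Nat.factorial (ℓ - 1)) *
        ∑ m ∈ Finset.Icc μ (ℓ - 1), (-1 : ℂ) ^ m * C μ m / (Nat.factorial m)) :
    (∀ μ ℓ : ℕ, 2 ≤ μ → μ ≤ ℓ →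
      C μ ℓ = (-1 : ℂ) ^ (ℓ - μ) * (Nat.factorial (ℓ - 1)) *
        ∑ T ∈ Finset.powersetCard (μ - 1) (Finset.Icc 1 (ℓ - 1)),
          (∏ k ∈ T, (k : ℂ))⁻¹) ∧
    (∀ μ ℓ : ℕ, 1 ≤ μ → μ ≤ ℓ →
      ‖C μ ℓ‖ ≤
        (Nat.factorial (ℓ - 1) : ℝ) / (Nat.factorial (μ - 1)) *
          (Nat.choose (ℓ - 1) (μ - 1))) := by
  have key := coeff_formula C hC1 hCrec
  constructor
  · intro μ ℓ hμ hℓ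
    obtain ⟨j, rfl⟩ : ∃ j, μ = j + 1 := ⟨μ - 1, by omega⟩
    obtain ⟨d, rfl⟩ : ∃ d, ℓ = j + d + 1 := ⟨ℓ - (j + 1), by omega⟩
    rw [key j (j + d) (by omega)]
    have e : j + d + 1 - (j + 1) = d := by omega
    have h3 : (-1 : ℂ) ^ j * (-1) ^ j = 1 := by rw [← mul_pow]; simp
    have h4 : (-1 : ℂ) ^ (j + d + j) = (-1) ^ d := by
      rw [pow_add, pow_add]; linear_combination (-1 : ℂ) ^ d * h3
    rw [e, h4]
    simp only [Nat.add_sub_cancel, symE]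
    push_cast
    rfl
  · intro μ ℓ hμ hℓ
    obtain ⟨j, rfl⟩ : ∃ j, μ = j + 1 := ⟨μ - 1, by omega⟩
    obtain ⟨n, rfl⟩ : ∃ n, ℓ = n + 1 := ⟨ℓ - 1, by omega⟩
    rw [key j n (by omega)]
    simp only [Nat.add_sub_cancel, norm_mul, norm_pow, norm_neg, norm_one, one_pow, one_mul,
      Complex.norm_natCast, Complex.norm_real, Real.norm_of_nonneg (symE_nonneg n j)]
    calc (n.factorial : ℝ) * symE n j ≤ n.factorial * ((n.choose j : ℝ) / j.factorial) := by
          have := symE_le n j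
          gcongr
      _ = _ := by ring
end

section
/- Let C_{μ,ℓ} (ℓ ≥ μ ≥ 1) be defined by C_{1,ℓ} = (-1)^{ℓ-1}(ℓ-1)! and C_{μ+1,ℓ} = (-1)^{ℓ-1}(ℓ-1)! Σ_{m=μ}^{ℓ-1} (-1)^m C_{μ,m}/m! for ℓ ≥ μ+1 ≥ 2. There exists an absolute constant κ > 0 such that for every w ∈ ℂ and all integers μ, M with 1 ≤ μ ≤ M ≤ |w|/2, | 1/w^μ − Σ_{ℓ=μ}^{M} C_{μ,ℓ} / ((w-1)(w-2)⋯(w-ℓ)) | ≤ κ · 2^M M! / ( (μ-1)! · |w| · |w-1| ⋯ |w-M| ). -/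
lemma aux_bound_s14 (C : ℕ → ℕ → ℂ)
    (hC1 : ∀ ℓ : ℕ, 1 ≤ ℓ → C 1 ℓ = (-1 : ℂ) ^ (ℓ - 1) * (Nat.factorial (ℓ - 1)))
    (hCrec : ∀ μ ℓ : ℕ, 1 ≤ μ → μ + 1 ≤ ℓ →
      C (μ + 1) ℓ = (-1 : ℂ) ^ (ℓ - 1) * (Nat.factorial (ℓ - 1)) *
        ∑ m ∈ Finset.Icc μ (ℓ - 1), (-1 : ℂ) ^ m * C μ m / (Nat.factorial m)) (n : ℕ) : ∀ l : ℕ, n ≤ l →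
      ‖C (n + 1) (l + 1)‖ * (Nat.factorial n) ≤ 2 ^ l * (Nat.factorial l) := by
  induction n with
  | zero =>
    intro l _
    rw [hC1 (l + 1) (by omega)]
    simp only [Nat.add_sub_cancel, norm_mul, norm_pow, norm_neg, norm_one, one_pow, one_mul,
      Complex.norm_natCast, Nat.factorial_zero, Nat.cast_one, mul_one]
    have h : (1 : ℝ) ≤ 2 ^ l := one_le_pow₀ (by norm_num)
    nlinarith [(Nat.cast_nonneg (Nat.factorial l) : (0 : ℝ) ≤ _)]
  | succ n ih =>
    intro l hl
    rw [hCrec (n + 1) (l + 1) (by omega) (by omega)]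
    simp only [Nat.add_sub_cancel, norm_mul, norm_pow, norm_neg, norm_one, one_pow, one_mul,
      Complex.norm_natCast]
    have key : ‖∑ m ∈ Finset.Icc (n + 1) l, (-1 : ℂ) ^ m * C (n + 1) m / (Nat.factorial m)‖
        * (Nat.factorial (n + 1)) ≤ 2 ^ l := by
      calc _ ≤ (∑ m ∈ Finset.Icc (n + 1) l,
              ‖(-1 : ℂ) ^ m * C (n + 1) m / (Nat.factorial m)‖) * (Nat.factorial (n + 1)) := by
            gcongr
            exact norm_sum_le _ _
        _ = ∑ m ∈ Finset.Icc (n + 1) l,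
              ‖(-1 : ℂ) ^ m * C (n + 1) m / (Nat.factorial m)‖ * (Nat.factorial (n + 1)) := by
            rw [Finset.sum_mul]
        _ ≤ ∑ m ∈ Finset.Icc (n + 1) l, (2 : ℝ) ^ m / 2 := by
            apply Finset.sum_le_sum
            intro m hm
            rw [Finset.mem_Icc] at hm
            obtain ⟨k, rfl⟩ : ∃ k, m = k + 1 := ⟨m - 1, by omega⟩
            have hk := ih k (by omega)
            simp only [norm_mul, norm_div, norm_pow, norm_neg, norm_one, one_pow, one_mul,
              Complex.norm_natCast]
            rw [div_mul_eq_mul_div, div_le_iff₀ (by positivity)]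
            simp only [Nat.factorial_succ, Nat.cast_mul]
            have hnk : ((n + 1 : ℕ) : ℝ) ≤ ((k + 1 : ℕ) : ℝ) := by exact_mod_cast hm.1
            calc _ = ((n + 1 : ℕ) : ℝ) * (‖C (n + 1) (k + 1)‖ * (Nat.factorial n)) := by ring
              _ ≤ ((k + 1 : ℕ) : ℝ) * (2 ^ k * (Nat.factorial k)) := by gcongr
              _ = _ := by ring
        _ ≤ 2 ^ l := by
            have h1 : ∑ m ∈ Finset.Icc (n + 1) l, (2 : ℝ) ^ m ≤ ∑ m ∈ Finset.range (l + 1), (2 : ℝ) ^ m := by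
              apply Finset.sum_le_sum_of_subset_of_nonneg
              · intro m hm
                rw [Finset.mem_Icc] at hm
                rw [Finset.mem_range]
                omega
              · intros
                positivity
            rw [geom_sum_eq (by norm_num)] at h1
            rw [pow_succ] at h1
            rw [← Finset.sum_div]
            linarith
    calc _ = (Nat.factorial l : ℝ) * (‖∑ m ∈ Finset.Icc (n + 1) l, (-1 : ℂ) ^ m * C (n + 1) m / (Nat.factorial m)‖
        * (Nat.factorial (n + 1))) := by ring
      _ ≤ (Nat.factorial l : ℝ) * 2 ^ l := by gcongr
      _ = _ := by ring

lemma aux_diag (C : ℕ → ℕ → ℂ)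
    (hCrec : ∀ μ ℓ : ℕ, 1 ≤ μ → μ + 1 ≤ ℓ →
      C (μ + 1) ℓ = (-1 : ℂ) ^ (ℓ - 1) * (Nat.factorial (ℓ - 1)) *
        ∑ m ∈ Finset.Icc μ (ℓ - 1), (-1 : ℂ) ^ m * C μ m / (Nat.factorial m)) (n : ℕ) :
    C (n + 2) (n + 2) = C (n + 1) (n + 1) := by
  rw [hCrec (n + 1) (n + 2) (by omega) (by omega)]
  have h : (Nat.factorial (n + 1) : ℂ) ≠ 0 := by exact_mod_cast Nat.factorial_ne_zero _
  have h2 : (-1 : ℂ) ^ (n + 1) * (-1 : ℂ) ^ (n + 1) = 1 := by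
    rw [← mul_pow]; norm_num
  simp only [show n + 2 - 1 = n + 1 by omega, Finset.Icc_self, Finset.sum_singleton]
  field_simp
  linear_combination C (n + 1) (n + 1) * h2

lemma aux_rec (C : ℕ → ℕ → ℂ)
    (hCrec : ∀ μ ℓ : ℕ, 1 ≤ μ → μ + 1 ≤ ℓ →
      C (μ + 1) ℓ = (-1 : ℂ) ^ (ℓ - 1) * (Nat.factorial (ℓ - 1)) *
        ∑ m ∈ Finset.Icc μ (ℓ - 1), (-1 : ℂ) ^ m * C μ m / (Nat.factorial m)) (n l : ℕ)
    (hl : n + 1 ≤ l) :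
    C (n + 2) (l + 2) = C (n + 1) (l + 1) - (l + 1) * C (n + 2) (l + 1) := by
  rw [hCrec (n + 1) (l + 2) (by omega) (by omega), hCrec (n + 1) (l + 1) (by omega) (by omega)]
  have h : (Nat.factorial (l + 1) : ℂ) ≠ 0 := by exact_mod_cast Nat.factorial_ne_zero _
  have h2 : (-1 : ℂ) ^ (l + 1) * (-1 : ℂ) ^ (l + 1) = 1 := by
    rw [← mul_pow]; norm_num
  simp only [show l + 2 - 1 = l + 1 by omega, Nat.add_sub_cancel]
  rw [Finset.sum_Icc_succ_top (by omega), mul_add]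
  have h3 : (-1 : ℂ) ^ (l + 1) * (Nat.factorial (l + 1)) *
      ((-1 : ℂ) ^ (l + 1) * C (n + 1) (l + 1) / (Nat.factorial (l + 1))) = C (n + 1) (l + 1) := by
    field_simp
    linear_combination C (n + 1) (l + 1) * h2
  rw [h3, Nat.factorial_succ, pow_succ]
  push_cast
  ring

lemma aux_sum (C : ℕ → ℕ → ℂ)
    (hCrec : ∀ μ ℓ : ℕ, 1 ≤ μ → μ + 1 ≤ ℓ →
      C (μ + 1) ℓ = (-1 : ℂ) ^ (ℓ - 1) * (Nat.factorial (ℓ - 1)) *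
        ∑ m ∈ Finset.Icc μ (ℓ - 1), (-1 : ℂ) ^ m * C μ m / (Nat.factorial m)) (n : ℕ)
    (w : ℂ) (hw : w ≠ 0) (M : ℕ) (hM : n + 1 ≤ M) : (∀ j : ℕ, 1 ≤ j → j ≤ M → w - j ≠ 0) →
    ∑ l ∈ Finset.Icc (n + 2) M, C (n + 2) l / ∏ j ∈ Finset.Icc 1 l, (w - j) =
      (∑ l ∈ Finset.Icc (n + 1) M, C (n + 1) l / ∏ j ∈ Finset.Icc 1 l, (w - j)) / w
      - C (n + 2) (M + 1) / (w * ∏ j ∈ Finset.Icc 1 M, (w - j)) := by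
  induction M, hM using Nat.le_induction with
  | base =>
    intro _
    rw [Finset.Icc_eq_empty (by omega), Finset.sum_empty, Finset.Icc_self, Finset.sum_singleton,
      aux_diag C hCrec n, div_div, mul_comm w, sub_self]
  | succ M hM ih =>
    intro hj
    have ih := ih (fun j h1 h2 => hj j h1 (by omega))
    rw [Finset.sum_Icc_succ_top (by omega), Finset.sum_Icc_succ_top (by omega), ih,
      aux_rec C hCrec n M hM, Finset.prod_Icc_succ_top (by omega)]
    have hP : ∏ j ∈ Finset.Icc 1 M, (w - (j : ℂ)) ≠ 0 := by
      rw [Finset.prod_ne_zero_iff]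
      intro j hj'
      rw [Finset.mem_Icc] at hj'
      exact hj j hj'.1 (by omega)
    have h1 := hj (M + 1) (by omega) le_rfl
    push_cast at h1 ⊢
    generalize ∏ j ∈ Finset.Icc 1 M, (w - (j : ℂ)) = P at *
    field_simp
    ring

lemma aux_one (w : ℂ) (hw : w ≠ 0) (M : ℕ) : (∀ j : ℕ, 1 ≤ j → j ≤ M → w - j ≠ 0) →
    1 / w - ∑ l ∈ Finset.Icc 1 M, ((-1 : ℂ) ^ (l - 1) * (Nat.factorial (l - 1))) /
        ∏ j ∈ Finset.Icc 1 l, (w - j) =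
      (-1 : ℂ) ^ M * (Nat.factorial M) / (w * ∏ j ∈ Finset.Icc 1 M, (w - j)) := by
  induction M with
  | zero => simp
  | succ M ih =>
    intro hj
    have ih := ih (fun j h1 h2 => hj j h1 (by omega))
    rw [Finset.sum_Icc_succ_top (by omega), ← sub_sub, ih, Finset.prod_Icc_succ_top (by omega)]
    have hP : ∏ j ∈ Finset.Icc 1 M, (w - (j : ℂ)) ≠ 0 := by
      rw [Finset.prod_ne_zero_iff]
      intro j hj'
      rw [Finset.mem_Icc] at hj'
      exact hj j hj'.1 (by omega)
    have h1 := hj (M + 1) (by omega) le_rfl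
    rw [Nat.factorial_succ, Nat.add_sub_cancel, pow_succ]
    push_cast at h1 ⊢
    generalize ∏ j ∈ Finset.Icc 1 M, (w - (j : ℂ)) = P at *
    field_simp
    ring

/-- Lemma 3.13: quantitative form of the asymptotic expansion
`1/w^μ ≈ Σ_ℓ C_{μ,ℓ}/((w-1)⋯(w-ℓ))`, valid for `μ ≤ M ≤ |w|/2`. -/
theorem stmt_14 (C : ℕ → ℕ → ℂ)
    (hC1 : ∀ ℓ : ℕ, 1 ≤ ℓ → C 1 ℓ = (-1 : ℂ) ^ (ℓ - 1) * (Nat.factorial (ℓ - 1)))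
    (hCrec : ∀ μ ℓ : ℕ, 1 ≤ μ → μ + 1 ≤ ℓ →
      C (μ + 1) ℓ = (-1 : ℂ) ^ (ℓ - 1) * (Nat.factorial (ℓ - 1)) *
        ∑ m ∈ Finset.Icc μ (ℓ - 1), (-1 : ℂ) ^ m * C μ m / (Nat.factorial m)) :
    ∃ κ : ℝ, 0 < κ ∧ ∀ w : ℂ, ∀ μ M : ℕ, 1 ≤ μ → μ ≤ M → (M : ℝ) ≤ ‖w‖ / 2 →
      ‖1 / w ^ μ -
          ∑ ℓ ∈ Finset.Icc μ M, C μ ℓ / ∏ j ∈ Finset.Icc 1 ℓ, (w - j)‖ ≤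
        κ * 2 ^ M * (Nat.factorial M) /
          ((Nat.factorial (μ - 1)) * ‖w‖ *
            ∏ j ∈ Finset.Icc 1 M, ‖w - j‖) := by
  refine ⟨2, by norm_num, ?_⟩
  intro w μ M hμ hμM hMw
  obtain ⟨n, rfl⟩ : ∃ n, μ = n + 1 := ⟨μ - 1, by omega⟩
  have hM1 : (1 : ℝ) ≤ M := by exact_mod_cast (by omega : 1 ≤ M)
  have hwpos : 0 < ‖w‖ := by linarith
  have hw : w ≠ 0 := norm_pos_iff.mp hwpos
  have hj : ∀ j : ℕ, 1 ≤ j → j ≤ M → w - j ≠ 0 := by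
    intro j _ h2 h0
    have h3 : w = j := sub_eq_zero.mp h0
    have h4 : ‖w‖ = j := by rw [h3, Complex.norm_natCast]
    have h5 : (j : ℝ) ≤ M := by exact_mod_cast h2
    linarith
  have hPn : ‖∏ j ∈ Finset.Icc 1 M, (w - (j : ℂ))‖ = ∏ j ∈ Finset.Icc 1 M, ‖w - (j : ℂ)‖ :=
    norm_prod _ _
  have hP : 0 < ∏ j ∈ Finset.Icc 1 M, ‖w - (j : ℂ)‖ := by
    apply Finset.prod_pos
    intro j hj'
    rw [Finset.mem_Icc] at hj'
    exact norm_pos_iff.mpr (hj j hj'.1 hj'.2)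
  rw [Nat.add_sub_cancel]
  clear hμ
  induction n with
  | zero =>
    have h1 := aux_one w hw M hj
    have h2 : ∑ l ∈ Finset.Icc (0 + 1) M, C (0 + 1) l / ∏ j ∈ Finset.Icc 1 l, (w - (j : ℂ)) =
        ∑ l ∈ Finset.Icc 1 M, ((-1 : ℂ) ^ (l - 1) * (Nat.factorial (l - 1))) /
        ∏ j ∈ Finset.Icc 1 l, (w - (j : ℂ)) := by
      apply Finset.sum_congr rfl
      intro l hl
      rw [Finset.mem_Icc] at hl
      rw [zero_add, hC1 l hl.1]
    rw [h2, zero_add, pow_one, h1, norm_div, norm_mul, norm_mul, hPn]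
    simp only [norm_pow, norm_neg, norm_one, one_pow, one_mul, Complex.norm_natCast,
      Nat.factorial_zero, Nat.cast_one]
    gcongr
    have h : (1 : ℝ) ≤ 2 ^ M := one_le_pow₀ (by norm_num)
    nlinarith [(Nat.cast_nonneg (Nat.factorial M) : (0 : ℝ) ≤ _)]
  | succ n ih =>
    have ih := ih (by omega)
    have hb := aux_bound_s14 C hC1 hCrec (n + 1) M (by omega)
    have hs := aux_sum C hCrec n w hw M (by omega) hj
    rw [show n + 1 + 1 = n + 2 from rfl] at hb ⊢
    rw [hs]
    set S := ∑ l ∈ Finset.Icc (n + 1) M, C (n + 1) l / ∏ j ∈ Finset.Icc 1 l, (w - (j : ℂ)) with hS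
    have e : 1 / w ^ (n + 2) - (S / w - C (n + 2) (M + 1) / (w * ∏ j ∈ Finset.Icc 1 M, (w - (j : ℂ))))
        = (1 / w ^ (n + 1) - S) / w + C (n + 2) (M + 1) / (w * ∏ j ∈ Finset.Icc 1 M, (w - (j : ℂ))) := by
      rw [pow_succ w (n + 1), ← div_div]
      ring
    rw [e]
    refine (norm_add_le _ _).trans ?_
    rw [norm_div, norm_div, norm_mul, hPn]
    generalize ∏ j ∈ Finset.Icc 1 M, ‖w - (j : ℂ)‖ = P at *
    have hf : (0 : ℝ) < (Nat.factorial n) := by exact_mod_cast Nat.factorial_pos n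
    have hf1 : (0 : ℝ) < (Nat.factorial (n + 1)) := by exact_mod_cast Nat.factorial_pos (n + 1)
    have hnM : ((n : ℝ) + 1) ≤ M := by exact_mod_cast (by omega : n + 1 ≤ M)
    have t2 : ‖C (n + 2) (M + 1)‖ / (‖w‖ * P) ≤
        2 ^ M * (Nat.factorial M) / ((Nat.factorial (n + 1)) * ‖w‖ * P) := by
      rw [mul_assoc (Nat.factorial (n + 1) : ℝ), ← div_div _ (Nat.factorial (n + 1) : ℝ)]
      gcongr
      rwa [le_div_iff₀ hf1]
    have t1 : ‖1 / w ^ (n + 1) - S‖ / ‖w‖ ≤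
        2 ^ M * (Nat.factorial M) / ((Nat.factorial (n + 1)) * ‖w‖ * P) := by
      calc _ ≤ 2 * 2 ^ M * (Nat.factorial M) / ((Nat.factorial n) * ‖w‖ * P) / ‖w‖ := by gcongr
        _ = 2 ^ M * (Nat.factorial M) / ((Nat.factorial n * (‖w‖ / 2)) * ‖w‖ * P) := by
          field_simp
        _ ≤ _ := by
          rw [Nat.factorial_succ]
          push_cast
          rw [mul_comm ((n : ℝ) + 1)]
          gcongr
          linarith
    calc _ ≤ _ := add_le_add t1 t2
      _ = _ := by ring
end

section
/- Let r ≥ 1, λ_1,…,λ_r > 0, μ_1,…,μ_r ∈ ℂ, θ = Im(2Σ_{j=1}^r(μ_j - 1/2)), and for ν ≥ 1 let R_ν(s) = B_{ν+1}(1 - 2s - iθ) + B_{ν+1}(1) - Σ_{j=1}^r ( B_{ν+1}(λ_j(1-s) + conj(μ_j)) + B_{ν+1}(1 - λ_j s - μ_j) ) / λ_j^ν, where B_n is the n-th Bernoulli polynomial. For μ ≥ 1 define V_μ(s) = (-1)^μ Σ_{m=1}^{μ} (1/m!) Σ_{ν_1 ≥ 1,…,ν_m ≥ 1, ν_1+⋯+ν_m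 = μ} ∏_{j=1}^{m} R_{ν_j}(s)/(ν_j(ν_j+1)). Then for every real c ≥ 1 there exists c' > 0 such that for all s ∈ ℂ and all integers μ with 1 ≤ μ ≤ c(|s|+1), one has |V_μ(s)| ≤ (c'(|s|+1))^{2μ}/μ!. -/
lemma aux_sum_two_pow (n : ℕ) : ∑ k ∈ Finset.range n, 2 ^ k ≤ 2 ^ n := by
  induction n with
  | zero => simp
  | succ n ih => rw [Finset.sum_range_succ, pow_succ]; omega

lemma aux_choose (n k : ℕ) (hk : k < n) :
    (n + 1).choose k * k.factorial * 2 ^ n ≤ (n + 1).factorial * 2 ^ k := by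
  have h1 := Nat.choose_mul_factorial_mul_factorial (show k ≤ n + 1 by omega)
  have h2 := @Nat.factorial_mul_pow_le_factorial 1 (n - k)
  rw [show 1 + (n - k) = n + 1 - k by omega] at h2
  simp only [Nat.factorial_one, one_mul, Nat.reduceAdd] at h2
  calc (n + 1).choose k * k.factorial * 2 ^ n
      = (n + 1).choose k * k.factorial * 2 ^ (n - k) * 2 ^ k := by
        rw [mul_assoc, mul_assoc, mul_assoc, ← pow_add, Nat.sub_add_cancel hk.le]
    _ ≤ (n + 1).choose k * k.factorial * (n + 1 - k).factorial * 2 ^ k := by gcongr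
    _ = _ := by rw [h1]

lemma aux_sum_choose (n : ℕ) :
    ∑ k ∈ Finset.range n, (n + 1).choose k * k.factorial ≤ (n + 1).factorial := by
  have : (∑ k ∈ Finset.range n, (n + 1).choose k * k.factorial) * 2 ^ n
      ≤ (n + 1).factorial * 2 ^ n := by
    rw [Finset.sum_mul]
    calc _ ≤ ∑ k ∈ Finset.range n, (n + 1).factorial * 2 ^ k :=
          Finset.sum_le_sum fun k hk => aux_choose n k (Finset.mem_range.1 hk)
      _ = (n + 1).factorial * ∑ k ∈ Finset.range n, 2 ^ k := by rw [Finset.mul_sum]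
      _ ≤ _ := Nat.mul_le_mul_left _ (aux_sum_two_pow n)
  exact Nat.le_of_mul_le_mul_right this (by positivity)

lemma aux_bernoulli (n : ℕ) : |bernoulli n| ≤ (n.factorial : ℚ) := by
  induction n using Nat.strong_induction_on with
  | _ n ih =>
    rcases Nat.eq_zero_or_pos n with rfl | hn
    · simp
    have h := sum_bernoulli (n + 1)
    rw [if_neg (by omega), Finset.sum_range_succ, Nat.choose_succ_self_right] at h
    have h3 : |((n + 1 : ℕ) : ℚ) * bernoulli n| ≤ ((n + 1).factorial : ℚ) := by
      rw [eq_neg_of_add_eq_zero_right h, abs_neg]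
      refine (Finset.abs_sum_le_sum_abs _ _).trans ?_
      refine le_trans (Finset.sum_le_sum (g := fun k => (((n + 1).choose k * k.factorial : ℕ) : ℚ))
        fun k hk => ?_) ?_
      · rw [abs_mul, Nat.abs_cast, Nat.cast_mul]
        exact mul_le_mul_of_nonneg_left (ih k (Finset.mem_range.1 hk)) (by positivity)
      · exact_mod_cast aux_sum_choose n
    rw [abs_mul, Nat.abs_cast, Nat.factorial_succ, Nat.cast_mul] at h3
    exact le_of_mul_le_mul_left h3 (by positivity)

lemma aux_bernoulli_poly (n : ℕ) (x : ℂ) :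
    ‖Polynomial.aeval x (Polynomial.bernoulli n)‖ ≤ (‖x‖ + n) ^ n := by
  rw [Polynomial.bernoulli_def, map_sum, add_pow]
  refine (norm_sum_le _ _).trans (Finset.sum_le_sum fun i hi => ?_)
  have hi' : i ≤ n := by have := Finset.mem_range.1 hi; omega
  rw [Polynomial.aeval_monomial, norm_mul, norm_pow]
  have hb : ‖(algebraMap ℚ ℂ) (bernoulli (n - i) * (n.choose i : ℚ))‖
      ≤ (n : ℝ) ^ (n - i) * (n.choose i : ℝ) := by
    have e : (algebraMap ℚ ℂ) (bernoulli (n - i) * (n.choose i : ℚ))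
      = ((bernoulli (n - i) : ℝ) : ℂ) * (n.choose i : ℂ) := by simp
    rw [e, norm_mul, Complex.norm_real, Complex.norm_natCast, Real.norm_eq_abs]
    refine mul_le_mul_of_nonneg_right ?_ (by positivity)
    have h1 : |((bernoulli (n - i) : ℚ) : ℝ)| ≤ ((n - i).factorial : ℝ) := by
      exact_mod_cast aux_bernoulli (n - i)
    refine h1.trans ?_
    have h2 : (n - i).factorial ≤ n ^ (n - i) :=
      (Nat.factorial_le_pow _).trans (Nat.pow_le_pow_left (by omega) _)
    exact_mod_cast h2
  calc _ ≤ ((n : ℝ) ^ (n - i) * (n.choose i : ℝ)) * ‖x‖ ^ i := by gcongr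
    _ = _ := by ring

lemma aux_card (m n : ℕ) : (Finset.Nat.antidiagonalTuple m n).card ≤ 2 ^ (m + n) := by
  have key : ∀ m n, (List.Nat.antidiagonalTuple m n).length ≤ 2 ^ (m + n) := by
    intro m
    induction m with
    | zero =>
      intro n
      cases n with
      | zero => simp
      | succ n => simp
    | succ m ih =>
      intro n
      rw [List.Nat.antidiagonalTuple, List.length_flatMap]
      simp only [List.length_map]
      have h2 : ∀ n : ℕ, ((List.Nat.antidiagonal n).map
          fun p => 2 ^ (m + p.2)).sum ≤ 2 ^ (m + 1 + n) := by
        intro n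
        induction n with
        | zero => simp [pow_succ]
        | succ n ihn =>
          rw [List.Nat.antidiagonal_succ]
          simp only [List.map_cons, List.sum_cons, List.map_map]
          have : (fun p : ℕ × ℕ => 2 ^ (m + p.2)) ∘ Prod.map Nat.succ id
            = fun p => 2 ^ (m + p.2) := by ext; simp
          rw [this]
          rw [show m + 1 + n = m + (n + 1) by ring] at ihn
          rw [show m + 1 + (n + 1) = m + (n + 1) + 1 by ring, pow_succ]
          omega
      refine le_trans (List.sum_le_sum fun p _ => ih p.2) (h2 n)
  exact key m n

lemma aux_factorial (m n : ℕ) (h : m ≤ n) : n.factorial ≤ m.factorial * n ^ (n - m) := by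
  have h1 := Nat.factorial_mul_descFactorial (n := n) (k := n - m) (by omega)
  rw [show n - (n - m) = m by omega] at h1
  rw [← h1]
  exact Nat.mul_le_mul_left _ (Nat.descFactorial_le_pow _ _)

lemma aux_term (m n : ℕ) (h : m ≤ n) (X Y : ℝ) (hX : 0 ≤ X) (hXY : X ≤ Y) (hY : (n : ℝ) ≤ Y) :
    1 / (m.factorial : ℝ) * X ^ m ≤ Y ^ n / (n.factorial : ℝ) := by
  rw [one_div_mul_eq_div, div_le_div_iff₀ (by positivity) (by positivity)]
  have h1 : (n.factorial : ℝ) ≤ m.factorial * (n : ℝ) ^ (n - m) := by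
    exact_mod_cast aux_factorial m n h
  calc X ^ m * (n.factorial : ℝ) ≤ Y ^ m * (m.factorial * Y ^ (n - m)) := by
        have hY0 : 0 ≤ Y := hX.trans hXY
        have h2 : (n.factorial : ℝ) ≤ m.factorial * Y ^ (n - m) := h1.trans (by gcongr)
        exact mul_le_mul (pow_le_pow_left₀ hX hXY m) h2 (by positivity) (by positivity)
    _ = Y ^ (m + (n - m)) * m.factorial := by rw [pow_add]; ring
    _ = _ := by rw [Nat.add_sub_cancel' h]

lemma aux_V (n : ℕ) (f : ℕ → ℂ) (X Y : ℝ) (hX : 1 ≤ X) (hXY : X ≤ Y)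
    (hY : (n : ℝ) ≤ Y) (hf : ∀ ν, ν ≤ n → ‖f ν‖ ≤ X ^ (ν + 1)) :
    ‖∑ m ∈ Finset.Icc 1 n, (1 / (Nat.factorial m : ℂ)) *
        ∑ ν ∈ (Finset.Nat.antidiagonalTuple m n).filter (fun ν => ∀ i, 1 ≤ ν i),
          ∏ i, f (ν i) / (((ν i : ℕ) : ℂ) * (((ν i : ℕ) : ℂ) + 1))‖ ≤
      (8 * Y) ^ (2 * n) / n.factorial := by
  have hX0 : 0 ≤ X := by linarith
  have hY0 : 0 ≤ Y := by linarith
  have hprod : ∀ m, ∀ ν ∈ (Finset.Nat.antidiagonalTuple m n).filter (fun ν => ∀ i, 1 ≤ ν i),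
      ‖∏ i, f (ν i) / (((ν i : ℕ) : ℂ) * (((ν i : ℕ) : ℂ) + 1))‖ ≤ X ^ (n + m) := by
    intro m ν hν
    rw [Finset.mem_filter, Finset.Nat.mem_antidiagonalTuple] at hν
    obtain ⟨hs, hpos⟩ := hν
    rw [norm_prod]
    have : X ^ (n + m) = ∏ i, X ^ (ν i + 1) := by
      rw [Finset.prod_pow_eq_pow_sum, Finset.sum_add_distrib, hs]; simp
    rw [this]
    refine Finset.prod_le_prod (fun i _ => norm_nonneg _) fun i _ => ?_
    have hle : ν i ≤ n := by
      rw [← hs]; exact Finset.single_le_sum (fun _ _ => Nat.zero_le _) (Finset.mem_univ i)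
    rw [norm_div]
    refine (div_le_self (norm_nonneg _) ?_).trans (hf _ hle)
    have e : ((ν i : ℕ) : ℂ) * (((ν i : ℕ) : ℂ) + 1) = ((ν i * (ν i + 1) : ℕ) : ℂ) := by
      push_cast; ring
    rw [e, Complex.norm_natCast]
    exact_mod_cast Nat.mul_pos (hpos i) (Nat.succ_pos _)
  have hterm : ∀ m ∈ Finset.Icc 1 n, ‖(1 / (Nat.factorial m : ℂ)) *
        ∑ ν ∈ (Finset.Nat.antidiagonalTuple m n).filter (fun ν => ∀ i, 1 ≤ ν i),
          ∏ i, f (ν i) / (((ν i : ℕ) : ℂ) * (((ν i : ℕ) : ℂ) + 1))‖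
        ≤ 4 ^ n * X ^ n * (Y ^ n / n.factorial) := by
    intro m hm
    have hmn : m ≤ n := (Finset.mem_Icc.1 hm).2
    rw [norm_mul, norm_div, norm_one, Complex.norm_natCast]
    have h1 := norm_sum_le_of_le _ (hprod m)
    rw [Finset.sum_const, nsmul_eq_mul] at h1
    have h2 : (((Finset.Nat.antidiagonalTuple m n).filter (fun ν => ∀ i, 1 ≤ ν i)).card : ℝ)
        ≤ 4 ^ n := by
      have : ((Finset.Nat.antidiagonalTuple m n).filter (fun ν => ∀ i, 1 ≤ ν i)).card ≤ 4 ^ n := by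
        refine (Finset.card_filter_le _ _).trans ((aux_card m n).trans ?_)
        rw [show 4 = 2 ^ 2 by norm_num, ← pow_mul]
        exact Nat.pow_le_pow_right (by norm_num) (by omega)
      exact_mod_cast this
    calc _ ≤ 1 / (m.factorial : ℝ) * (4 ^ n * X ^ (n + m)) := by
          refine mul_le_mul_of_nonneg_left (h1.trans ?_) (by positivity)
          exact mul_le_mul_of_nonneg_right h2 (by positivity)
      _ = 4 ^ n * X ^ n * (1 / (m.factorial : ℝ) * X ^ m) := by rw [pow_add]; ring
      _ ≤ _ := mul_le_mul_of_nonneg_left (aux_term m n hmn X Y hX0 hXY hY) (by positivity)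
  refine (norm_sum_le_of_le _ hterm).trans ?_
  rw [Finset.sum_const, nsmul_eq_mul, Nat.card_Icc, Nat.add_sub_cancel]
  have hn2 : (n : ℝ) ≤ 2 ^ n := by exact_mod_cast Nat.lt_two_pow_self.le
  calc (n : ℝ) * (4 ^ n * X ^ n * (Y ^ n / n.factorial))
      ≤ 2 ^ n * (4 ^ n * Y ^ n * (Y ^ n / n.factorial)) := by gcongr
    _ = 8 ^ n * Y ^ (2 * n) / n.factorial := by
        rw [show (8 : ℝ) = 2 * 4 by norm_num, mul_pow, two_mul n, pow_add]; ring
    _ ≤ 8 ^ (2 * n) * Y ^ (2 * n) / n.factorial := by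
        gcongr
        · norm_num
        · omega
    _ = _ := by rw [mul_pow]


set_option maxHeartbeats 2000000 in
/-- Lemma 3.16: the bound `|V_μ(s)| ≤ (c'(|s|+1))^{2μ}/μ!` for the polynomials `V_μ(s)`
built from the polynomials `R_ν(s)`; the inner sum runs over ordered `m`-tuples of
positive integers summing to `μ`. -/
theorem stmt_16
    (r : ℕ) (hr : 1 ≤ r) (lam : Fin r → ℝ) (hlam : ∀ j, 0 < lam j)
    (mu : Fin r → ℂ) (θ : ℝ) (hθ : θ = (2 * ∑ j, (mu j - 1 / 2)).im)
    (R : ℕ → ℂ → ℂ)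
    (hR : ∀ (ν : ℕ) (s : ℂ), R ν s =
      Polynomial.aeval (1 - 2 * s - (θ : ℂ) * Complex.I) (Polynomial.bernoulli (ν + 1)) +
        Polynomial.aeval (1 : ℂ) (Polynomial.bernoulli (ν + 1)) -
        ∑ j, (Polynomial.aeval ((lam j : ℂ) * (1 - s) + (starRingEnd ℂ) (mu j))
              (Polynomial.bernoulli (ν + 1)) +
            Polynomial.aeval (1 - (lam j : ℂ) * s - mu j) (Polynomial.bernoulli (ν + 1))) /
          (lam j : ℂ) ^ ν)
    (V : ℕ → ℂ → ℂ)
    (hV : ∀ (μ : ℕ) (s : ℂ), 1 ≤ μ → V μ s =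
      (-1 : ℂ) ^ μ * ∑ m ∈ Finset.Icc 1 μ, (1 / (Nat.factorial m : ℂ)) *
        ∑ ν ∈ (Finset.Nat.antidiagonalTuple m μ).filter (fun ν => ∀ i, 1 ≤ ν i),
          ∏ i, R (ν i) s / (((ν i : ℕ) : ℂ) * (((ν i : ℕ) : ℂ) + 1)))
    (c : ℝ) (hc : 1 ≤ c) :
    ∃ c' : ℝ, 0 < c' ∧ ∀ s : ℂ, ∀ μ : ℕ, 1 ≤ μ → (μ : ℝ) ≤ c * (‖s‖ + 1) →
      ‖V μ s‖ ≤ (c' * (‖s‖ + 1)) ^ (2 * μ) / (Nat.factorial μ) := by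
  set A : ℝ := 3 + |θ| + ∑ j, (lam j + ‖mu j‖) with hA
  set L : ℝ := 1 + ∑ j, (lam j)⁻¹ with hL
  have hsum0 : 0 ≤ ∑ j, (lam j + ‖mu j‖) :=
    Finset.sum_nonneg fun j _ => add_nonneg (hlam j).le (norm_nonneg _)
  have hj : ∀ j, lam j + ‖mu j‖ ≤ ∑ j, (lam j + ‖mu j‖) := fun j =>
    Finset.single_le_sum (f := fun j => lam j + ‖mu j‖)
      (fun j _ => add_nonneg (hlam j).le (norm_nonneg _)) (Finset.mem_univ j)
  have hL1 : 1 ≤ L := by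
    have : 0 ≤ ∑ j, (lam j)⁻¹ := Finset.sum_nonneg fun j _ => (inv_pos.2 (hlam j)).le
    linarith
  have hLj : ∀ j, (lam j)⁻¹ ≤ L := fun j => by
    have := Finset.single_le_sum (f := fun j => (lam j)⁻¹)
      (fun j _ => (inv_pos.2 (hlam j)).le) (Finset.mem_univ j)
    linarith
  have hθ0 := abs_nonneg θ
  set D : ℝ := A + 2 * c with hD
  have hD1 : 1 ≤ D := by linarith
  set E : ℝ := (2 + 2 * r) * (D * L) with hE
  have hDL : 1 ≤ D * L := one_le_mul_of_one_le_of_one_le hD1 hL1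
  have hr0 : (0 : ℝ) ≤ r := Nat.cast_nonneg r
  have hE1 : 1 ≤ E := by nlinarith
  refine ⟨8 * (c * E), by positivity, fun s μ hμ hμc => ?_⟩
  set T : ℝ := ‖s‖ + 1 with hT
  have hs0 := norm_nonneg s
  have hT1 : 1 ≤ T := by linarith
  have hDT : 1 ≤ D * T := one_le_mul_of_one_le_of_one_le hD1 hT1
  have hET : 1 ≤ E * T := one_le_mul_of_one_le_of_one_le hE1 hT1
  have hB : ∀ ν, ν ≤ μ → ∀ x : ℂ, ‖x‖ ≤ A * T →
      ‖Polynomial.aeval x (Polynomial.bernoulli (ν + 1))‖ ≤ (D * T) ^ (ν + 1) := by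
    intro ν hν x hx
    refine (aux_bernoulli_poly _ x).trans ?_
    have h1 : (ν : ℝ) ≤ μ := by exact_mod_cast hν
    have h2 : 1 ≤ c * T := one_le_mul_of_one_le_of_one_le hc hT1
    refine pow_le_pow_left₀ (by positivity) ?_ _
    push_cast
    rw [hD]; linarith
  have hx1 : ‖1 - 2 * s - (θ : ℂ) * Complex.I‖ ≤ A * T := by
    have h1 : ‖1 - 2 * s - (θ : ℂ) * Complex.I‖ ≤ 1 + 2 * ‖s‖ + |θ| := by
      refine (norm_sub_le _ _).trans (add_le_add ((norm_sub_le _ _).trans ?_) ?_) <;> simp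
    nlinarith
  have hx2 : ‖(1 : ℂ)‖ ≤ A * T := by rw [norm_one]; nlinarith
  have hx3 : ∀ j, ‖(lam j : ℂ) * (1 - s) + (starRingEnd ℂ) (mu j)‖ ≤ A * T := by
    intro j
    have h1 : ‖(lam j : ℂ) * (1 - s) + (starRingEnd ℂ) (mu j)‖ ≤ lam j * T + ‖mu j‖ := by
      refine (norm_add_le _ _).trans (add_le_add ?_ (by simp))
      rw [norm_mul, Complex.norm_real, Real.norm_of_nonneg (hlam j).le]
      refine mul_le_mul_of_nonneg_left ((norm_sub_le _ _).trans ?_) (hlam j).le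
      rw [norm_one, hT, add_comm]
    have h2 := hj j
    have h3 := norm_nonneg (mu j)
    calc _ ≤ _ := h1
      _ ≤ (lam j + ‖mu j‖) * T := by nlinarith
      _ ≤ A * T := by gcongr; linarith
  have hx4 : ∀ j, ‖1 - (lam j : ℂ) * s - mu j‖ ≤ A * T := by
    intro j
    have h1 : ‖1 - (lam j : ℂ) * s - mu j‖ ≤ 1 + lam j * ‖s‖ + ‖mu j‖ := by
      refine (norm_sub_le _ _).trans (add_le_add ((norm_sub_le _ _).trans ?_) le_rfl)
      rw [norm_mul, Complex.norm_real, Real.norm_of_nonneg (hlam j).le, norm_one]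
    have h2 := hj j
    have h3 := norm_nonneg (mu j)
    have h4 := (hlam j).le
    calc _ ≤ _ := h1
      _ ≤ (1 + lam j + ‖mu j‖) * T := by nlinarith
      _ ≤ A * T := by gcongr; linarith
  have hRb : ∀ ν, ν ≤ μ → ‖R ν s‖ ≤ (E * T) ^ (ν + 1) := by
    intro ν hν
    rw [hR]
    have hb := hB ν hν
    have hj2 : ∀ j ∈ Finset.univ, ‖(Polynomial.aeval ((lam j : ℂ) * (1 - s) + (starRingEnd ℂ) (mu j))
              (Polynomial.bernoulli (ν + 1)) +
            Polynomial.aeval (1 - (lam j : ℂ) * s - mu j) (Polynomial.bernoulli (ν + 1))) /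
          (lam j : ℂ) ^ ν‖ ≤ 2 * (D * T) ^ (ν + 1) * L ^ (ν + 1) := by
      intro j _
      rw [div_eq_mul_inv, norm_mul]
      refine mul_le_mul ?_ ?_ (norm_nonneg _) (by positivity)
      · have := norm_add_le_of_le (hb _ (hx3 j)) (hb _ (hx4 j))
        linarith
      · rw [norm_inv, norm_pow, Complex.norm_real, Real.norm_of_nonneg (hlam j).le, ← inv_pow]
        exact (pow_le_pow_left₀ (inv_pos.2 (hlam j)).le (hLj j) ν).trans
          (pow_le_pow_right₀ hL1 (Nat.le_succ ν))
    have h1 := norm_sub_le_of_le (norm_add_le_of_le (hb _ hx1) (hb _ hx2))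
      (norm_sum_le_of_le _ hj2)
    refine h1.trans ?_
    rw [Finset.sum_const, nsmul_eq_mul, Finset.card_univ, Fintype.card_fin]
    have hLp : 1 ≤ L ^ (ν + 1) := one_le_pow₀ hL1
    have hDp : 0 ≤ (D * T) ^ (ν + 1) := by positivity
    have hEe : (E * T) ^ (ν + 1) = (2 + 2 * (r : ℝ)) ^ (ν + 1) * ((D * T) ^ (ν + 1) * L ^ (ν + 1)) := by
      rw [← mul_pow, ← mul_pow, hE]; ring
    rw [hEe]
    calc _ ≤ (2 + 2 * (r : ℝ)) * ((D * T) ^ (ν + 1) * L ^ (ν + 1)) := by nlinarith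
      _ ≤ _ := mul_le_mul_of_nonneg_right (le_self_pow₀ (by linarith) (Nat.succ_ne_zero ν))
        (by positivity)
  rw [hV μ s hμ, norm_mul, norm_pow, norm_neg, norm_one, one_pow, one_mul]
  have hXY : E * T ≤ c * E * T := by
    have hET0 : 0 ≤ E * T := by linarith
    calc E * T ≤ c * (E * T) := le_mul_of_one_le_left hET0 hc
      _ = c * E * T := (mul_assoc c E T).symm
  have hmuY : (μ : ℝ) ≤ c * E * T := by
    refine hμc.trans ?_
    rw [mul_right_comm]
    exact le_mul_of_one_le_right (by positivity) hE1
  have hfin := aux_V μ (fun ν => R ν s) (E * T) (c * E * T) hET hXY hmuY hRb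
  rw [← mul_assoc] at hfin
  exact hfin
end

section
/- For every real x > 0 and every integer M with 1 ≤ M ≤ √2·x, one has Σ_{μ=1}^{M} x^{2μ}/(μ!)² ≤ (2x)^{2M}/(M!)². -/
/-- Lemma 3.17: `Σ_{μ=1}^M x^{2μ}/(μ!)² ≤ (2x)^{2M}/(M!)²` for `1 ≤ M ≤ √2·x`. -/
theorem stmt_17 (x : ℝ) (hx : 0 < x) (M : ℕ) (hM : 1 ≤ M)
    (hM2 : (M : ℝ) ≤ Real.sqrt 2 * x) :
    ∑ μ ∈ Finset.Icc 1 M, x ^ (2 * μ) / (Nat.factorial μ) ^ 2 ≤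
      (2 * x) ^ (2 * M) / (Nat.factorial M) ^ 2 := by
  clear hM
  induction M with
  | zero => simp
  | succ n ih =>
    rw [Finset.sum_Icc_succ_top (by omega)]
    have h1 := ih (by push_cast at hM2; linarith)
    have h2 : ((n : ℝ) + 1) ^ 2 ≤ 2 * x ^ 2 := by
      push_cast at hM2
      calc ((n : ℝ) + 1) ^ 2 ≤ (Real.sqrt 2 * x) ^ 2 := by gcongr
        _ = 2 * x ^ 2 := by rw [mul_pow, Real.sq_sqrt (by norm_num)]
    have h4 : (1 : ℝ) ≤ 4 ^ n := one_le_pow₀ (by norm_num)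
    have hf : (0 : ℝ) < (Nat.factorial n : ℝ) := by positivity
    have e : (2 * x) ^ (2 * n) / (Nat.factorial n : ℝ) ^ 2
        = x ^ (2 * n) * (4 ^ n * ((n : ℝ) + 1) ^ 2) / (Nat.factorial (n + 1) : ℝ) ^ 2 := by
      rw [Nat.factorial_succ, mul_pow, pow_mul 2 2 n]
      push_cast
      field_simp
      norm_num
    refine (add_le_add_left h1 _).trans ?_
    rw [e, ← add_div]
    gcongr
    have e2 : (2 * x) ^ (2 * (n + 1)) = x ^ (2 * n) * (4 * 4 ^ n * x ^ 2) := by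
      rw [mul_pow, pow_mul 2 2 (n + 1)]
      norm_num
      ring
    have e3 : x ^ (2 * (n + 1)) = x ^ (2 * n) * x ^ 2 := by ring
    rw [e2, e3, ← mul_add]
    gcongr
    have h5 := mul_le_mul_of_nonneg_left h2 (by positivity : (0 : ℝ) ≤ 4 ^ n)
    have h6 := mul_le_mul_of_nonneg_right h4 (sq_nonneg x)
    nlinarith [sq_nonneg x]
end
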